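/- arXiv:1408.1877 — 2 statements merged into one kernel-verified Lean document; each statement's English description precedes it below -/
import Mathlib

section
/- Let d ≥ 3, λ = (d−2)/2, and let 2 ≤ q ≤ 2 + 2/λ. Then there exists a constant C > 0 such that for every integer n ≥ 1 and every f ∈ L²(S^{d-1}, σ), ‖proj_n f‖_q ≤ C · n^{λ(1/2 − 1/q)} · ‖f‖_2. -/
open MeasureTheory Metric
open scoped ENNReal

noncomputable section

/-- The unit sphere `S^{d-1}` in `ℝ^d`. -/
abbrev Sph (d : ℕ) := Metric.sphere (0 : EuclideanSpace ℝ (Fin d)) 1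

/-- The surface measure `σ` on the unit sphere in `ℝ^d`. -/
def sphMeasure (d : ℕ) : Measure (Sph d) :=
  (volume : Measure (EuclideanSpace ℝ (Fin d))).toSphere

/-- `Y : S^{d-1} → ℝ` is a spherical harmonic of degree `n` if it is the restriction to
`S^{d-1}` of a polynomial in `d` real variables that is homogeneous of degree `n` and
harmonic (the sum of its second partial derivatives vanishes identically). -/
def IsSphericalHarmonic (d n : ℕ) (Y : Sph d → ℝ) : Prop :=
  ∃ P : MvPolynomial (Fin d) ℝ, P.IsHomogeneous n ∧
    (∑ i : Fin d, MvPolynomial.pderiv i (MvPolynomial.pderiv i P)) = 0 ∧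
    ∀ x : Sph d, Y x = MvPolynomial.eval (fun i => (x : EuclideanSpace ℝ (Fin d)) i) P

/-- `H_k^d`: the subspace of `L²(S^{d-1}, σ)` consisting of (equivalence classes of)
spherical harmonics of degree `k`. -/
def Hspace (d k : ℕ) : Submodule ℝ (Lp ℝ 2 (sphMeasure d)) :=
  Submodule.span ℝ {f : Lp ℝ 2 (sphMeasure d) |
    ∃ Y : Sph d → ℝ, IsSphericalHarmonic d k Y ∧ ⇑f =ᵐ[sphMeasure d] Y}

/-- `T` is the orthogonal projection of `L²(S^{d-1}, σ)` onto `H_k^d`: it maps into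
`H_k^d` and `f - T f` is orthogonal to `H_k^d` for every `f`. -/
def IsOrthProjOnto (d k : ℕ)
    (T : Lp ℝ 2 (sphMeasure d) → Lp ℝ 2 (sphMeasure d)) : Prop :=
  ∀ f : Lp ℝ 2 (sphMeasure d), T f ∈ Hspace d k ∧
    ∀ g ∈ Hspace d k, @inner ℝ _ _ (f - T f) g = 0

/-- The constant `c_n = (Γ(d/2)/(2π^{d/2})) ((d+2n-2)/(d+n-2)) Γ(d+n-1)/(Γ(n+1)Γ(d-1))`. -/
def cCoef (d n : ℕ) : ℝ :=
  Real.Gamma ((d : ℝ) / 2) / (2 * Real.pi ^ ((d : ℝ) / 2)) *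
    (((d : ℝ) + 2 * (n : ℝ) - 2) / ((d : ℝ) + (n : ℝ) - 2)) *
    (Real.Gamma ((d : ℝ) + (n : ℝ) - 1) /
      (Real.Gamma ((n : ℝ) + 1) * Real.Gamma ((d : ℝ) - 1)))

/-- The operator `T_n f = ∑_{j=0}^{d-2} (-1)^j binom(d-2, j) (c_n / c_{n+2j}) proj_{n+2j} f`
on `L²(S^{d-1}, σ)`, built from the orthogonal projections `proj_k` onto `H_k^d`. -/
def Tconv (d : ℕ) (proj : ℕ → Lp ℝ 2 (sphMeasure d) → Lp ℝ 2 (sphMeasure d)) (n : ℕ)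
    (f : Lp ℝ 2 (sphMeasure d)) : Lp ℝ 2 (sphMeasure d) :=
  ∑ j ∈ Finset.range (d - 1),
    ((-1 : ℝ) ^ j * ((d - 2).choose j : ℝ) * (cCoef d n / cCoef d (n + 2 * j))) •
      proj (n + 2 * j) f

/-- Evaluation of a polynomial at a point of Euclidean space. -/
def polyEval {d : ℕ} (x : EuclideanSpace ℝ (Fin d)) : MvPolynomial (Fin d) ℝ →+* ℝ :=
  MvPolynomial.eval (fun i => x i)

lemma continuous_polyEval {d : ℕ} (P : MvPolynomial (Fin d) ℝ) :
    Continuous fun x : EuclideanSpace ℝ (Fin d) => polyEval x P :=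
  P.continuous_eval.comp (by fun_prop)

lemma polyEval_smul {d m : ℕ} {P : MvPolynomial (Fin d) ℝ} (hP : P.IsHomogeneous m) (r : ℝ)
    (x : EuclideanSpace ℝ (Fin d)) : polyEval (r • x) P = r ^ m * polyEval x P := by
  simp only [polyEval, MvPolynomial.eval_eq, Finset.mul_sum]
  refine Finset.sum_congr rfl fun s hs => ?_
  have h1 : ∑ i ∈ s.support, s i = m := by
    simpa [Finsupp.weight_apply, Finsupp.sum] using hP (MvPolynomial.mem_support_iff.1 hs)
  simp only [PiLp.smul_apply, smul_eq_mul, mul_pow, Finset.prod_mul_distrib,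
    Finset.prod_pow_eq_pow_sum]
  rw [h1]; ring

lemma hasDerivAt_polyEval_line {d : ℕ} (P : MvPolynomial (Fin d) ℝ)
    (x : EuclideanSpace ℝ (Fin d)) (i : Fin d) (t : ℝ) :
    HasDerivAt (fun t : ℝ => polyEval (x + t • EuclideanSpace.single i 1) P)
      (polyEval (x + t • EuclideanSpace.single i 1) (MvPolynomial.pderiv i P)) t := by
  induction P using MvPolynomial.induction_on with
  | C a => simpa [polyEval] using hasDerivAt_const t a
  | add p q hp hq => simp only [map_add]; exact hp.add hq
  | mul_X p j hp =>
    have h1 : HasDerivAt (fun t : ℝ => polyEval (x + t • EuclideanSpace.single i 1)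
        (MvPolynomial.X j)) (if j = i then 1 else 0) t := by
      simp only [polyEval, MvPolynomial.eval_X, PiLp.add_apply, PiLp.smul_apply,
        smul_eq_mul, PiLp.single_apply]
      simpa using ((hasDerivAt_id t).mul_const (if j = i then (1 : ℝ) else 0)).const_add (x j)
    have h2 := hp.mul h1
    simp only [map_mul, Derivation.leibniz, smul_eq_mul, map_add, MvPolynomial.pderiv_X] at h2 ⊢
    refine h2.congr_deriv ?_
    by_cases h : j = i
    · subst h; simp; ring
    · simp [h]; ring

lemma exists_abs_polyEval_le {d : ℕ} (P : MvPolynomial (Fin d) ℝ) :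
    ∀ b : ℝ, 0 < b → ∃ C : ℝ, ∀ x : EuclideanSpace ℝ (Fin d),
      |polyEval x P| ≤ C * Real.exp (b * ‖x‖ ^ 2) := by
  induction P using MvPolynomial.induction_on with
  | C a =>
    intro b hb
    refine ⟨|a|, fun x => ?_⟩
    simp only [polyEval, MvPolynomial.eval_C]
    exact le_mul_of_one_le_right (abs_nonneg _) (Real.one_le_exp (by positivity))
  | add p q hp hq =>
    intro b hb
    obtain ⟨C, hC⟩ := hp b hb
    obtain ⟨D, hD⟩ := hq b hb
    refine ⟨C + D, fun x => ?_⟩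
    rw [map_add, add_mul]
    exact (abs_add_le _ _).trans (add_le_add (hC x) (hD x))
  | mul_X p j hp =>
    intro b hb
    obtain ⟨C, hC⟩ := hp (b / 2) (by positivity)
    refine ⟨C * (1 + 2 / b), fun x => ?_⟩
    have h1 : |polyEval x (MvPolynomial.X j)| ≤ (1 + 2 / b) * Real.exp (b / 2 * ‖x‖ ^ 2) := by
      simp only [polyEval, MvPolynomial.eval_X]
      have h2 : |x j| ≤ ‖x‖ := by simpa using PiLp.norm_apply_le x j
      have h3 := Real.add_one_le_exp (b / 2 * ‖x‖ ^ 2)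
      have h5 : ‖x‖ ≤ (1 + 2 / b) * (b / 2 * ‖x‖ ^ 2 + 1) := by
        have : (1 + 2 / b) * (b / 2 * ‖x‖ ^ 2 + 1) = b / 2 * ‖x‖ ^ 2 + 1 + ‖x‖ ^ 2 + 2 / b := by
          field_simp; ring
        rw [this]
        have : 0 < 2 / b := by positivity
        have : 0 ≤ b / 2 * ‖x‖ ^ 2 := by positivity
        nlinarith [sq_nonneg (‖x‖ - 1)]
      exact (h2.trans h5).trans (mul_le_mul_of_nonneg_left h3 (by positivity))
    rw [map_mul, abs_mul]
    calc _ ≤ (C * Real.exp (b / 2 * ‖x‖ ^ 2)) * ((1 + 2 / b) * Real.exp (b / 2 * ‖x‖ ^ 2)) :=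
          mul_le_mul (hC x) h1 (abs_nonneg _) ((abs_nonneg _).trans (hC x))
      _ = C * (1 + 2 / b) * (Real.exp (b / 2 * ‖x‖ ^ 2) * Real.exp (b / 2 * ‖x‖ ^ 2)) := by ring
      _ = _ := by rw [← Real.exp_add]; ring_nf

lemma integrable_polyEval_mul_gaussian {d : ℕ} (P : MvPolynomial (Fin d) ℝ) :
    Integrable fun x : EuclideanSpace ℝ (Fin d) => polyEval x P * Real.exp (-‖x‖ ^ 2 / 2) := by
  obtain ⟨C, hC⟩ := exists_abs_polyEval_le P (1 / 4) (by norm_num)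
  have h0 : Integrable fun x : EuclideanSpace ℝ (Fin d) => Real.exp (-(1 / 4) * ‖x‖ ^ 2) := by
    have := (GaussianFourier.integrable_cexp_neg_mul_sq_norm_add (b := ((1 / 4 : ℝ) : ℂ))
      (V := EuclideanSpace ℝ (Fin d)) (by norm_num) 0 0).norm
    refine this.congr (.of_forall fun x => ?_)
    simp only [Complex.norm_exp]
    congr 1
    norm_cast
    simp
  refine (h0.const_mul C).mono' ?_ (.of_forall fun x => ?_)
  · exact ((continuous_polyEval P).mul (by fun_prop)).aestronglyMeasurable
  · rw [norm_mul, Real.norm_eq_abs, Real.norm_of_nonneg (Real.exp_pos _).le]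
    calc _ ≤ C * Real.exp (1 / 4 * ‖x‖ ^ 2) * Real.exp (-‖x‖ ^ 2 / 2) := by gcongr; exact hC x
      _ = _ := by rw [mul_assoc, ← Real.exp_add]; ring_nf

lemma integral_pderiv_gaussian {d : ℕ} (P : MvPolynomial (Fin d) ℝ) (i : Fin d) :
    ∫ x : EuclideanSpace ℝ (Fin d), polyEval x (MvPolynomial.X i * P) * Real.exp (-‖x‖ ^ 2 / 2) =
      ∫ x : EuclideanSpace ℝ (Fin d),
        polyEval x (MvPolynomial.pderiv i P) * Real.exp (-‖x‖ ^ 2 / 2) := by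
  have h := integral_bilinear_hasLineDerivAt_right_eq_neg_left_of_integrable
    (μ := (volume : Measure (EuclideanSpace ℝ (Fin d))))
    (f := fun x => polyEval x P) (f' := fun x => polyEval x (MvPolynomial.pderiv i P))
    (g := fun x => Real.exp (-‖x‖ ^ 2 / 2)) (g' := fun x => -x i * Real.exp (-‖x‖ ^ 2 / 2))
    (v := EuclideanSpace.single i 1) (B := ContinuousLinearMap.mul ℝ ℝ)
    (by simpa using integrable_polyEval_mul_gaussian _) ?_
    (by simpa using integrable_polyEval_mul_gaussian _) ?_ ?_
  · simp only [ContinuousLinearMap.mul_apply'] at h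
    rw [← neg_inj, ← h, ← integral_neg]
    congr 1; ext x
    simp [polyEval]; ring
  · refine (integrable_polyEval_mul_gaussian (MvPolynomial.X i * P)).neg.congr
      (.of_forall fun x => ?_)
    simp [polyEval]; ring
  · intro x _
    simpa [HasLineDerivAt] using hasDerivAt_polyEval_line P x i 0
  · intro x _
    have h1 : HasDerivAt (fun t : ℝ => ‖x + t • EuclideanSpace.single i (1 : ℝ)‖ ^ 2)
        (2 * x i) 0 := by
      have : (fun t : ℝ => ‖x + t • EuclideanSpace.single i (1 : ℝ)‖ ^ 2) =
          fun t : ℝ => ‖x‖ ^ 2 + t * (2 * x i) + t ^ 2 := by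
        ext t
        rw [norm_add_sq_real, inner_smul_right, norm_smul, EuclideanSpace.inner_single_right]
        simp; ring
      rw [this]
      refine ((((hasDerivAt_id (0 : ℝ)).mul_const (2 * x i)).const_add (‖x‖ ^ 2)).add
        ((hasDerivAt_id (0 : ℝ)).pow 2)).congr_deriv ?_
      simp
    have h2 := (h1.neg.div_const 2).exp
    rw [HasLineDerivAt]
    refine h2.congr_deriv ?_
    simp
    ring

/-- The integral of a polynomial over the unit sphere. -/
def sphInt {d : ℕ} (P : MvPolynomial (Fin d) ℝ) : ℝ :=
  ∫ x : Sph d, polyEval (x : EuclideanSpace ℝ (Fin d)) P ∂(sphMeasure d)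

instance (d : ℕ) : IsFiniteMeasure (sphMeasure d) := by
  unfold sphMeasure; infer_instance

/-- The radial Gaussian moments. -/
def radialMoment (d m : ℕ) : ℝ :=
  ∫ r in Set.Ioi (0 : ℝ), r ^ (d - 1 : ℕ) * (r ^ m * Real.exp (-r ^ 2 / 2))

lemma radialMoment_eq {d : ℕ} (hd : 1 ≤ d) (m : ℕ) :
    radialMoment d m = (1 / 2 : ℝ) ^ (-((d : ℝ) + m) / 2) * (1 / 2) *
      Real.Gamma (((d : ℝ) + m) / 2) := by
  have h := integral_rpow_mul_exp_neg_mul_rpow (p := 2) (q := (d : ℝ) - 1 + m) (b := 1 / 2)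
    (by norm_num) (by
      have : (1 : ℝ) ≤ d := by exact_mod_cast hd
      have : (0 : ℝ) ≤ m := by positivity
      linarith) (by norm_num)
  rw [show (d : ℝ) - 1 + m + 1 = d + m by ring] at h
  rw [← h, radialMoment]
  refine setIntegral_congr_fun measurableSet_Ioi fun r hr => ?_
  rw [← mul_assoc, ← pow_add, ← Real.rpow_natCast r (d - 1 + m), Nat.cast_add, Nat.cast_sub hd]
  norm_num
  ring_nf
  simp

lemma radialMoment_pos {d : ℕ} (hd : 1 ≤ d) (m : ℕ) : 0 < radialMoment d m := by
  rw [radialMoment_eq hd]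
  have : (0 : ℝ) < ((d : ℝ) + m) / 2 := by
    have : (1 : ℝ) ≤ d := by exact_mod_cast hd
    positivity
  have := Real.Gamma_pos_of_pos this
  positivity

lemma radialMoment_add_two {d : ℕ} (hd : 1 ≤ d) (m : ℕ) :
    radialMoment d (m + 2) = ((d : ℝ) + m) * radialMoment d m := by
  have h0 : (0 : ℝ) < ((d : ℝ) + m) / 2 := by
    have : (1 : ℝ) ≤ d := by exact_mod_cast hd
    positivity
  rw [radialMoment_eq hd, radialMoment_eq hd]
  push_cast
  rw [show ((d : ℝ) + (m + 2)) / 2 = (d + m) / 2 + 1 by ring, Real.Gamma_add_one h0.ne',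
    show -((d : ℝ) + (m + 2)) / 2 = -(d + m) / 2 + (-1) by ring,
    Real.rpow_add (by norm_num), Real.rpow_neg_one]
  norm_num
  ring

lemma integral_polar_gaussian {d : ℕ} (hd : 1 ≤ d) {m : ℕ} {P : MvPolynomial (Fin d) ℝ}
    (hP : P.IsHomogeneous m) :
    ∫ x : EuclideanSpace ℝ (Fin d), polyEval x P * Real.exp (-‖x‖ ^ 2 / 2) =
      sphInt P * radialMoment d m := by
  have : Nonempty (Fin d) := ⟨⟨0, hd⟩⟩
  set E := EuclideanSpace ℝ (Fin d)
  let μ : Measure E := volume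
  have hdim : Module.finrank ℝ E = d := by simp [E]
  calc _ = ∫ x : ({(0)}ᶜ : Set E), polyEval (x : E) P * Real.exp (-‖(x : E)‖ ^ 2 / 2)
        ∂(μ.comap (↑)) := by
        rw [integral_subtype_comap (measurableSet_singleton _).compl
          fun x : E ↦ polyEval x P * Real.exp (-‖x‖ ^ 2 / 2), restrict_compl_singleton]
    _ = ∫ x, polyEval (x.1 : E) P * ((x.2 : ℝ) ^ m * Real.exp (-(x.2 : ℝ) ^ 2 / 2))
          ∂μ.toSphere.prod (.volumeIoiPow (Module.finrank ℝ E - 1)) := by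
        rw [← (μ.measurePreserving_homeomorphUnitSphereProd).integral_comp
          (Homeomorph.measurableEmbedding _)]
        congr 1; ext x
        have h1 : (x : E) = ((homeomorphUnitSphereProd E x).2 : ℝ) •
            ((homeomorphUnitSphereProd E x).1 : E) := by
          rw [← homeomorphUnitSphereProd_symm_apply_coe, Homeomorph.symm_apply_apply]
        have h2 : ‖(x : E)‖ = ((homeomorphUnitSphereProd E x).2 : ℝ) := by simp
        have h3 : polyEval (x : E) P = ((homeomorphUnitSphereProd E x).2 : ℝ) ^ m *
            polyEval ((homeomorphUnitSphereProd E x).1 : E) P := by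
          rw [← polyEval_smul hP, ← h1]
        rw [h2, h3]
        ring
    _ = sphInt P * ∫ r : Set.Ioi (0 : ℝ), ((r : ℝ) ^ m * Real.exp (-(r : ℝ) ^ 2 / 2))
          ∂(.volumeIoiPow (Module.finrank ℝ E - 1)) := by
        rw [integral_prod_mul (μ := μ.toSphere)
          (ν := .volumeIoiPow (Module.finrank ℝ E - 1))
          (fun x : sphere (0 : E) 1 => polyEval (x : E) P)
          (fun r : Set.Ioi (0 : ℝ) => ((r : ℝ) ^ m * Real.exp (-(r : ℝ) ^ 2 / 2)))]
        rfl
    _ = _ := by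
        congr 1
        simp only [Measure.volumeIoiPow, ENNReal.ofReal]
        rw [integral_withDensity_eq_integral_smul, hdim,
          integral_subtype_comap measurableSet_Ioi fun a : ℝ ↦
            Real.toNNReal (a ^ (d - 1)) • (a ^ m * Real.exp (-a ^ 2 / 2)), radialMoment,
          setIntegral_congr_fun measurableSet_Ioi fun x hx ↦ ?_]
        · rw [NNReal.smul_def, Real.coe_toNNReal _ (pow_nonneg hx.out.le _), smul_eq_mul]
        · exact (measurable_subtype_coe.pow_const _).real_toNNReal

lemma integrable_polyEval_sph {d : ℕ} (P : MvPolynomial (Fin d) ℝ) :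
    Integrable (fun x : Sph d => polyEval (x : EuclideanSpace ℝ (Fin d)) P) (sphMeasure d) :=
  ((continuous_polyEval P).comp continuous_subtype_val).integrable_of_hasCompactSupport
    (HasCompactSupport.of_compactSpace _)

/-- Integration of polynomials over the sphere, as a linear map. -/
def sphIntL (d : ℕ) : MvPolynomial (Fin d) ℝ →ₗ[ℝ] ℝ where
  toFun := sphInt
  map_add' P Q := by
    simp only [sphInt, map_add]
    exact integral_add (integrable_polyEval_sph P) (integrable_polyEval_sph Q)
  map_smul' c P := by
    simp only [sphInt, polyEval, MvPolynomial.smul_eval, RingHom.id_apply, smul_eq_mul]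
    exact integral_const_mul _ _

/-- The divergence theorem for polynomials on the unit ball, in polar coordinates. -/
lemma sphIntL_X_mul {d : ℕ} (hd : 2 ≤ d) {m : ℕ} {P : MvPolynomial (Fin d) ℝ}
    (hP : P.IsHomogeneous m) (i : Fin d) :
    ((m : ℝ) + d - 1) * sphIntL d (MvPolynomial.X i * P) =
      sphIntL d (MvPolynomial.pderiv i P) := by
  have h := integral_pderiv_gaussian P i
  rw [integral_polar_gaussian (by omega) ((MvPolynomial.isHomogeneous_X ℝ i).mul hP),
    integral_polar_gaussian (by omega) hP.pderiv] at h
  change _ * sphInt _ = sphInt _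
  rcases m with _ | m
  · have h0 : MvPolynomial.pderiv i P = 0 := by
      rw [← MvPolynomial.totalDegree_zero_iff_isHomogeneous,
        MvPolynomial.totalDegree_eq_zero_iff_eq_C] at hP
      rw [hP]
      simp
    have h1 : sphInt (0 : MvPolynomial (Fin d) ℝ) = 0 := (sphIntL d).map_zero
    rw [h0, h1, zero_mul] at h
    rw [h0, h1]
    rcases mul_eq_zero.1 h with h | h
    · rw [h, mul_zero]
    · exact absurd h (radialMoment_pos (by omega) _).ne'
  · have h2 := radialMoment_pos (d := d) (by omega) m
    rw [show 1 + (m + 1) = m + 2 by ring, radialMoment_add_two (by omega)] at h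
    simp only [Nat.add_sub_cancel] at h
    apply mul_right_cancel₀ h2.ne'
    rw [← h]
    push_cast
    ring

/-- The Laplacian of a polynomial. -/
def lap {d : ℕ} (P : MvPolynomial (Fin d) ℝ) : MvPolynomial (Fin d) ℝ :=
  ∑ i : Fin d, MvPolynomial.pderiv i (MvPolynomial.pderiv i P)

/-- The squared norm as a polynomial. -/
def normSqPoly (d : ℕ) : MvPolynomial (Fin d) ℝ := ∑ i : Fin d, MvPolynomial.X i ^ 2

/-- The linear form `⟨y, ·⟩` as a polynomial. -/
def linPoly {d : ℕ} (y : EuclideanSpace ℝ (Fin d)) : MvPolynomial (Fin d) ℝ :=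
  ∑ i : Fin d, y i • MvPolynomial.X i

/-- The directional derivative along `y`. -/
def dirDeriv {d : ℕ} (y : EuclideanSpace ℝ (Fin d)) :
    Derivation ℝ (MvPolynomial (Fin d) ℝ) (MvPolynomial (Fin d) ℝ) :=
  ∑ i : Fin d, y i • MvPolynomial.pderiv i

lemma dirDeriv_apply {d : ℕ} (y : EuclideanSpace ℝ (Fin d)) (P : MvPolynomial (Fin d) ℝ) :
    dirDeriv y P = ∑ i : Fin d, y i • MvPolynomial.pderiv i P := by
  have h : ∀ s : Finset (Fin d), (∑ i ∈ s, y i • MvPolynomial.pderiv i :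
      Derivation ℝ (MvPolynomial (Fin d) ℝ) (MvPolynomial (Fin d) ℝ)) P =
      ∑ i ∈ s, y i • MvPolynomial.pderiv i P := by
    intro s
    induction s using Finset.cons_induction with
    | empty => simp
    | cons a s ha ih => rw [Finset.sum_cons, Finset.sum_cons, Derivation.add_apply, ih]; rfl
  exact h _

lemma pderiv_comm_apply {d : ℕ} (i j : Fin d) (P : MvPolynomial (Fin d) ℝ) :
    MvPolynomial.pderiv i (MvPolynomial.pderiv j P) =
      MvPolynomial.pderiv j (MvPolynomial.pderiv i P) := by
  have h : ⁅(MvPolynomial.pderiv i : Derivation ℝ (MvPolynomial (Fin d) ℝ)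
      (MvPolynomial (Fin d) ℝ)), (MvPolynomial.pderiv j : Derivation ℝ
      (MvPolynomial (Fin d) ℝ) (MvPolynomial (Fin d) ℝ))⁆ = 0 := by
    refine MvPolynomial.derivation_ext fun k => ?_
    rw [Derivation.commutator_apply, MvPolynomial.pderiv_X, MvPolynomial.pderiv_X]
    by_cases h1 : k = i <;> by_cases h2 : k = j <;> simp [Pi.single_apply, h1, h2] <;> aesop
  have h1 := congrArg (fun D => D P) h
  simpa [Derivation.commutator_apply, sub_eq_zero] using h1

lemma lap_add {d : ℕ} (P Q : MvPolynomial (Fin d) ℝ) : lap (P + Q) = lap P + lap Q := by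
  simp [lap, Finset.sum_add_distrib]

lemma lap_smul {d : ℕ} (c : ℝ) (P : MvPolynomial (Fin d) ℝ) : lap (c • P) = c • lap P := by
  simp [lap, Finset.smul_sum]

lemma lap_dirDeriv {d : ℕ} (y : EuclideanSpace ℝ (Fin d)) (P : MvPolynomial (Fin d) ℝ) :
    lap (dirDeriv y P) = dirDeriv y (lap P) := by
  simp only [lap, dirDeriv_apply, map_sum, Derivation.map_smul]
  refine Finset.sum_congr rfl fun i _ => Finset.sum_congr rfl fun j _ => ?_
  rw [pderiv_comm_apply j i, pderiv_comm_apply j i]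

lemma lap_mul {d : ℕ} (P Q : MvPolynomial (Fin d) ℝ) :
    lap (P * Q) = P * lap Q +
      2 • (∑ i, MvPolynomial.pderiv i P * MvPolynomial.pderiv i Q) + lap P * Q := by
  simp only [lap, Derivation.leibniz, map_add, smul_eq_mul, Finset.mul_sum, Finset.sum_mul,
    Finset.smul_sum, ← Finset.sum_add_distrib]
  refine Finset.sum_congr rfl fun i _ => ?_
  rw [two_nsmul]
  ring

lemma pderiv_linPoly {d : ℕ} (y : EuclideanSpace ℝ (Fin d)) (i : Fin d) :
    MvPolynomial.pderiv i (linPoly y) = MvPolynomial.C (y i) := by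
  simp only [linPoly, map_sum, Derivation.map_smul, MvPolynomial.pderiv_X, Pi.single_apply]
  simp [MvPolynomial.smul_eq_C_mul]

lemma pderiv_normSqPoly {d : ℕ} (i : Fin d) :
    MvPolynomial.pderiv i (normSqPoly d) = 2 * MvPolynomial.X i := by
  simp only [normSqPoly, map_sum, Derivation.leibniz_pow, MvPolynomial.pderiv_X, Pi.single_apply]
  simp

lemma lap_linPoly_mul {d : ℕ} (y : EuclideanSpace ℝ (Fin d)) (P : MvPolynomial (Fin d) ℝ) :
    lap (linPoly y * P) = linPoly y * lap P + (2 : ℝ) • dirDeriv y P := by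
  have h0 : lap (linPoly y) = 0 := by
    simp [lap, pderiv_linPoly]
  rw [lap_mul, h0, zero_mul, add_zero, dirDeriv_apply]
  simp only [pderiv_linPoly, MvPolynomial.smul_eq_C_mul, nsmul_eq_mul]
  rw [show (MvPolynomial.C (2 : ℝ) : MvPolynomial (Fin d) ℝ) = 2 from map_ofNat _ _]
  norm_num

lemma sum_X_mul_pderiv_eq {d k : ℕ} {P : MvPolynomial (Fin d) ℝ} (hP : P.IsHomogeneous k) :
    ∑ i, MvPolynomial.X i * MvPolynomial.pderiv i P = (k : ℝ) • P := by
  rw [hP.sum_X_mul_pderiv, MvPolynomial.smul_eq_C_mul]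
  simp

lemma lap_normSqPoly_mul {d k : ℕ} {P : MvPolynomial (Fin d) ℝ} (hP : P.IsHomogeneous k) :
    lap (normSqPoly d * P) = normSqPoly d * lap P + (2 * (d : ℝ) + 4 * k) • P := by
  have h0 : lap (normSqPoly d) = MvPolynomial.C (2 * (d : ℝ)) := by
    simp only [lap, pderiv_normSqPoly]
    have : ∀ i : Fin d, MvPolynomial.pderiv i (2 * MvPolynomial.X i : MvPolynomial (Fin d) ℝ) = 2 := by
      intro i
      rw [two_mul, map_add, MvPolynomial.pderiv_X_self]
      norm_num
    simp only [this]
    rw [map_mul, show (MvPolynomial.C (2 : ℝ) : MvPolynomial (Fin d) ℝ) = 2 from map_ofNat _ _]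
    simp
    ring
  rw [lap_mul, h0]
  simp only [pderiv_normSqPoly, mul_assoc, ← Finset.mul_sum]
  rw [sum_X_mul_pderiv_eq hP]
  simp only [MvPolynomial.smul_eq_C_mul, nsmul_eq_mul, map_add, map_mul, map_natCast]
  push_cast
  rw [show (MvPolynomial.C (4 : ℝ) : MvPolynomial (Fin d) ℝ) = 4 from map_ofNat _ _]
  ring

lemma sphIntL_dirDeriv {d m : ℕ} (hd : 2 ≤ d) {P : MvPolynomial (Fin d) ℝ}
    (hP : P.IsHomogeneous m) (y : EuclideanSpace ℝ (Fin d)) :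
    ((m : ℝ) + d - 1) * sphIntL d (linPoly y * P) = sphIntL d (dirDeriv y P) := by
  rw [linPoly, dirDeriv_apply, Finset.sum_mul, map_sum, map_sum, Finset.mul_sum]
  refine Finset.sum_congr rfl fun i _ => ?_
  rw [smul_mul_assoc, map_smul, map_smul, ← sphIntL_X_mul hd hP i]
  simp only [smul_eq_mul]
  ring

lemma polyEval_normSqPoly {d : ℕ} (x : Sph d) :
    polyEval (x : EuclideanSpace ℝ (Fin d)) (normSqPoly d) = 1 := by
  have h : ‖(x : EuclideanSpace ℝ (Fin d))‖ ^ 2 = 1 := by simp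
  rw [EuclideanSpace.norm_sq_eq] at h
  simpa [polyEval, normSqPoly] using h

lemma sphIntL_normSqPoly_mul {d : ℕ} (P : MvPolynomial (Fin d) ℝ) :
    sphIntL d (normSqPoly d * P) = sphIntL d P := by
  change sphInt _ = sphInt _
  simp only [sphInt, map_mul, polyEval_normSqPoly, one_mul]

lemma isHomogeneous_dirDeriv {d k : ℕ} {P : MvPolynomial (Fin d) ℝ}
    (hP : P.IsHomogeneous (k + 1)) (y : EuclideanSpace ℝ (Fin d)) :
    (dirDeriv y P).IsHomogeneous k := by
  rw [dirDeriv_apply]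
  refine MvPolynomial.IsHomogeneous.sum _ _ _ fun i _ => ?_
  rw [MvPolynomial.smul_eq_C_mul]
  exact hP.pderiv.C_mul _

lemma sphIntL_gradient {d j k : ℕ} (hd : 2 ≤ d) {P Q : MvPolynomial (Fin d) ℝ}
    (hP : P.IsHomogeneous j) (hQ : Q.IsHomogeneous k) (hQl : lap Q = 0) :
    (k : ℝ) * ((j : ℝ) + k + d - 2) * sphIntL d (P * Q) =
      sphIntL d (∑ i, MvPolynomial.pderiv i P * MvPolynomial.pderiv i Q) := by
  rcases k with _ | k
  · have h0 : ∀ i, MvPolynomial.pderiv i Q = 0 := by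
      intro i
      rw [← MvPolynomial.totalDegree_zero_iff_isHomogeneous,
        MvPolynomial.totalDegree_eq_zero_iff_eq_C] at hQ
      rw [hQ]
      simp
    simp [h0]
  have h1 : ∀ i, ((j : ℝ) + (k + 1 : ℕ) + d - 2) *
      sphIntL d (P * (MvPolynomial.X i * MvPolynomial.pderiv i Q)) =
      sphIntL d (MvPolynomial.pderiv i P * MvPolynomial.pderiv i Q) +
        sphIntL d (P * MvPolynomial.pderiv i (MvPolynomial.pderiv i Q)) := by
    intro i
    have h := sphIntL_X_mul hd (hP.mul (hQ.pderiv (i := i))) i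
    rw [Derivation.leibniz, map_add, smul_eq_mul, smul_eq_mul] at h
    rw [mul_comm (MvPolynomial.pderiv i P), add_comm (sphIntL d _), ← h]
    rw [show P * (MvPolynomial.X i * MvPolynomial.pderiv i Q) =
      MvPolynomial.X i * (P * MvPolynomial.pderiv i Q) by ring]
    push_cast
    ring
  have h2 : sphIntL d (P * ∑ i, MvPolynomial.X i * MvPolynomial.pderiv i Q) =
      ((k + 1 : ℕ) : ℝ) * sphIntL d (P * Q) := by
    rw [sum_X_mul_pderiv_eq hQ, mul_smul_comm, map_smul, smul_eq_mul]
  have h3 : sphIntL d (P * lap Q) = 0 := by rw [hQl, mul_zero, map_zero]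
  rw [Finset.mul_sum, map_sum] at h2
  rw [lap, Finset.mul_sum, map_sum] at h3
  have h4 := Finset.sum_congr (rfl : (Finset.univ : Finset (Fin d)) = _) fun i _ => h1 i
  rw [← Finset.mul_sum, h2, Finset.sum_add_distrib, h3, add_zero] at h4
  rw [map_sum, ← h4]
  ring

lemma sphIntL_mul_eq_zero {d j k : ℕ} (hd : 3 ≤ d) {P Q : MvPolynomial (Fin d) ℝ}
    (hP : P.IsHomogeneous j) (hPl : lap P = 0) (hQ : Q.IsHomogeneous k) (hQl : lap Q = 0)
    (hjk : j ≠ k) : sphIntL d (P * Q) = 0 := by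
  have h1 := sphIntL_gradient (by omega) hP hQ hQl
  have h2 := sphIntL_gradient (by omega) hQ hP hPl
  rw [mul_comm Q P] at h2
  simp only [mul_comm (MvPolynomial.pderiv _ Q)] at h2
  rw [← h1] at h2
  have h3 : ((j : ℝ) - k) * ((j : ℝ) + k + d - 2) * sphIntL d (P * Q) = 0 := by
    linear_combination h2
  have hd' : (3 : ℝ) ≤ d := by exact_mod_cast hd
  have h4 : (j : ℝ) + k + d - 2 ≠ 0 := by
    have : (0 : ℝ) ≤ j := by positivity
    have : (0 : ℝ) ≤ k := by positivity
    linarith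
  have h5 : (j : ℝ) - k ≠ 0 := by
    rw [sub_ne_zero]; exact_mod_cast hjk
  simpa [h4, h5] using h3

/-- The Gegenbauer polynomials `C_k^l(t)`. -/
def geg (l t : ℝ) : ℕ → ℝ
  | 0 => 1
  | 1 => 2 * l * t
  | k + 2 => (1 / ((k : ℝ) + 2)) *
      (2 * (k + 1 + l) * (t * geg l t (k + 1)) - (k + 2 * l) * geg l t k)

/-- The solid zonal harmonics with pole `y`. -/
def zonalPoly {d : ℕ} (y : EuclideanSpace ℝ (Fin d)) (l : ℝ) : ℕ → MvPolynomial (Fin d) ℝ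
  | 0 => 1
  | 1 => (2 * l) • linPoly y
  | k + 2 => (1 / ((k : ℝ) + 2)) • ((2 * (k + 1 + l)) • (linPoly y * zonalPoly y l (k + 1)) -
      ((k : ℝ) + 2 * l) • (normSqPoly d * zonalPoly y l k))

lemma polyEval_smul_poly {d : ℕ} (x : EuclideanSpace ℝ (Fin d)) (c : ℝ)
    (P : MvPolynomial (Fin d) ℝ) : polyEval x (c • P) = c * polyEval x P := by
  simp [polyEval, MvPolynomial.smul_eval]

lemma polyEval_linPoly {d : ℕ} (x y : EuclideanSpace ℝ (Fin d)) :
    polyEval x (linPoly y) = inner ℝ x y := by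
  simp [linPoly, polyEval, MvPolynomial.smul_eval, PiLp.inner_apply]

lemma polyEval_zonalPoly {d : ℕ} (x : Sph d) (y : EuclideanSpace ℝ (Fin d)) (l : ℝ) (k : ℕ) :
    polyEval (x : EuclideanSpace ℝ (Fin d)) (zonalPoly y l k) =
      geg l (inner ℝ (x : EuclideanSpace ℝ (Fin d)) y) k := by
  induction k using Nat.twoStepInduction with
  | zero => simp [zonalPoly, geg]
  | one => simp [zonalPoly, geg, polyEval_smul_poly, polyEval_linPoly]
  | more k h1 h2 =>
    simp only [zonalPoly, geg, polyEval_smul_poly, map_sub, map_mul, polyEval_linPoly,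
      polyEval_normSqPoly, h1, h2, one_mul]

lemma isHomogeneous_linPoly {d : ℕ} (y : EuclideanSpace ℝ (Fin d)) :
    (linPoly y).IsHomogeneous 1 := by
  refine MvPolynomial.IsHomogeneous.sum _ _ _ fun i _ => ?_
  rw [MvPolynomial.smul_eq_C_mul]
  exact (MvPolynomial.isHomogeneous_X ℝ i).C_mul _

lemma isHomogeneous_normSqPoly (d : ℕ) : (normSqPoly d).IsHomogeneous 2 := by
  refine MvPolynomial.IsHomogeneous.sum _ _ _ fun i _ => ?_
  simpa using (MvPolynomial.isHomogeneous_X ℝ i).pow 2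

lemma isHomogeneous_const_smul {d k : ℕ} (c : ℝ) {P : MvPolynomial (Fin d) ℝ}
    (hP : P.IsHomogeneous k) : (c • P).IsHomogeneous k := by
  rw [MvPolynomial.smul_eq_C_mul]
  exact hP.C_mul _

lemma isHomogeneous_zonalPoly {d : ℕ} (y : EuclideanSpace ℝ (Fin d)) (l : ℝ) (k : ℕ) :
    (zonalPoly y l k).IsHomogeneous k := by
  induction k using Nat.twoStepInduction with
  | zero => exact MvPolynomial.isHomogeneous_one _ _
  | one => exact isHomogeneous_const_smul _ (isHomogeneous_linPoly y)
  | more k h1 h2 =>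
    refine isHomogeneous_const_smul _ (.sub (isHomogeneous_const_smul _ ?_)
      (isHomogeneous_const_smul _ ?_))
    · simpa [add_comm, add_left_comm] using (isHomogeneous_linPoly y).mul h2
    · simpa [add_comm] using (isHomogeneous_normSqPoly d).mul h1

lemma dirDeriv_linPoly {d : ℕ} {y : EuclideanSpace ℝ (Fin d)} (hy : ‖y‖ = 1) :
    dirDeriv y (linPoly y) = 1 := by
  have h : ‖y‖ ^ 2 = 1 := by simp [hy]
  rw [EuclideanSpace.norm_sq_eq] at h
  rw [dirDeriv_apply]
  simp only [pderiv_linPoly, MvPolynomial.smul_eq_C_mul, ← map_mul, ← map_sum]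
  rw [← map_one (MvPolynomial.C), ← h]
  simp [sq]

lemma dirDeriv_normSqPoly {d : ℕ} (y : EuclideanSpace ℝ (Fin d)) :
    dirDeriv y (normSqPoly d) = (2 : ℝ) • linPoly y := by
  rw [dirDeriv_apply, linPoly, Finset.smul_sum]
  refine Finset.sum_congr rfl fun i _ => ?_
  rw [pderiv_normSqPoly, smul_comm (2 : ℝ), ofNat_smul_eq_nsmul ℝ 2, nsmul_eq_mul]
  norm_num

lemma dirDeriv_zonalPoly {d : ℕ} {y : EuclideanSpace ℝ (Fin d)} (hy : ‖y‖ = 1) (l : ℝ) (k : ℕ) :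
    dirDeriv y (zonalPoly y l (k + 1)) = (2 * l + k) • zonalPoly y l k := by
  induction k using Nat.twoStepInduction with
  | zero => simp [zonalPoly, Derivation.map_smul, dirDeriv_linPoly hy]
  | one =>
    simp only [zonalPoly, Derivation.map_smul, map_sub, Derivation.leibniz, dirDeriv_linPoly hy,
      dirDeriv_normSqPoly, smul_eq_mul, mul_one, mul_smul_comm, smul_sub, smul_add, smul_smul]
    match_scalars
    ring
  | more k h1 h2 =>
    have e : zonalPoly y l (k + 2) = (1 / ((k : ℝ) + 2)) •
      ((2 * (k + 1 + l)) • (linPoly y * zonalPoly y l (k + 1)) -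
      ((k : ℝ) + 2 * l) • (normSqPoly d * zonalPoly y l k)) := rfl
    have e2 : zonalPoly y l (k + 2 + 1) = (1 / (((k + 1 : ℕ) : ℝ) + 2)) •
      ((2 * ((k + 1 : ℕ) + 1 + l)) • (linPoly y * zonalPoly y l (k + 2)) -
      (((k + 1 : ℕ) : ℝ) + 2 * l) • (normSqPoly d * zonalPoly y l (k + 1))) := rfl
    rw [e2]
    simp only [Derivation.map_smul, map_sub, Derivation.leibniz, dirDeriv_linPoly hy,
      dirDeriv_normSqPoly, smul_eq_mul]
    rw [h1, h2]
    have e3 : normSqPoly d * ((2 * l + (k : ℝ)) • zonalPoly y l k) =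
        (2 * (k + 1 + l)) • (linPoly y * zonalPoly y l (k + 1)) -
          ((k : ℝ) + 2) • zonalPoly y l (k + 2) := by
      rw [e, smul_smul, mul_one_div_cancel (by positivity), one_smul, mul_smul_comm,
        add_comm (2 * l)]
      abel
    rw [e3]
    simp only [mul_smul_comm, mul_one, smul_sub, smul_add, smul_smul,
      mul_comm (zonalPoly y l (k + 1)) (linPoly y)]
    push_cast
    have hk : ((k : ℝ) + 1 + 2) ≠ 0 := by positivity
    match_scalars <;> field_simp <;> ring

lemma lap_zonalPoly {d : ℕ} {y : EuclideanSpace ℝ (Fin d)} (hy : ‖y‖ = 1) {l : ℝ}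
    (hl : l = ((d : ℝ) - 2) / 2) (k : ℕ) : lap (zonalPoly y l k) = 0 := by
  induction k using Nat.twoStepInduction with
  | zero => simp [zonalPoly, lap]
  | one => simp [zonalPoly, lap, pderiv_linPoly]
  | more k h1 h2 =>
    have hs : ∀ P Q : MvPolynomial (Fin d) ℝ, lap (P - Q) = lap P - lap Q := by
      intro P Q
      rw [sub_eq_add_neg, ← neg_one_smul ℝ, lap_add, lap_smul, neg_one_smul, ← sub_eq_add_neg]
    rw [zonalPoly, lap_smul, hs, lap_smul, lap_smul, lap_linPoly_mul,
      lap_normSqPoly_mul (isHomogeneous_zonalPoly y l k), h1, h2, dirDeriv_zonalPoly hy]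
    simp only [mul_zero, zero_add, smul_smul, ← sub_smul]
    have : 2 * ((k : ℝ) + 1 + l) * (2 * (2 * l + k)) - (k + 2 * l) * (2 * d + 4 * k) = 0 := by
      rw [hl]; ring
    rw [this, mul_zero, zero_smul]

lemma polyEval_dirDeriv_self {d k : ℕ} {P : MvPolynomial (Fin d) ℝ} (hP : P.IsHomogeneous k)
    (y : EuclideanSpace ℝ (Fin d)) : polyEval y (dirDeriv y P) = k * polyEval y P := by
  have h := congrArg (polyEval y) (sum_X_mul_pderiv_eq hP)
  rw [polyEval_smul_poly] at h
  rw [← h, dirDeriv_apply, map_sum, map_sum]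
  refine Finset.sum_congr rfl fun i _ => ?_
  rw [polyEval_smul_poly, map_mul]
  simp [polyEval]

/-- The reproducing property of zonal harmonics. -/
lemma sphIntL_zonalPoly_mul {d : ℕ} (hd : 3 ≤ d) {l : ℝ} (hl : l = ((d : ℝ) - 2) / 2)
    {y : EuclideanSpace ℝ (Fin d)} (hy : ‖y‖ = 1) (k : ℕ) :
    ∀ Y : MvPolynomial (Fin d) ℝ, Y.IsHomogeneous k → lap Y = 0 →
      (l + k) * sphIntL d (zonalPoly y l k * Y) =
        (sphMeasure d).real Set.univ * l * polyEval y Y := by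
  have hd' : (3 : ℝ) ≤ d := by exact_mod_cast hd
  have hl0 : 0 < l := by rw [hl]; linarith
  induction k with
  | zero =>
    intro Y hY _
    rw [← MvPolynomial.totalDegree_zero_iff_isHomogeneous,
        MvPolynomial.totalDegree_eq_zero_iff_eq_C] at hY
    rw [hY]
    change _ * sphInt _ = _
    simp [zonalPoly, sphInt, polyEval]
    ring
  | succ k ih =>
    intro Y hY hYl
    have hz := isHomogeneous_zonalPoly y l
    have hzl := lap_zonalPoly hy hl
    -- three-term recursion, tested against `Y`
    have h1 : ((k : ℝ) + 1) * sphIntL d (zonalPoly y l (k + 1) * Y) =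
        2 * (k + l) * sphIntL d (linPoly y * (zonalPoly y l k * Y)) := by
      rcases k with _ | k
      · simp [zonalPoly, mul_assoc]
      · rw [zonalPoly, smul_mul_assoc, sub_mul, smul_mul_assoc, smul_mul_assoc, map_smul,
          map_sub, map_smul, map_smul, mul_assoc (normSqPoly d), sphIntL_normSqPoly_mul,
          sphIntL_mul_eq_zero hd (hz k) (hzl k) hY hYl (by omega), mul_assoc (linPoly y)]
        simp only [smul_eq_mul]
        push_cast
        field_simp
        ring
    have h2 := sphIntL_dirDeriv (by omega) ((hz k).mul hY) y
    have h3 : sphIntL d (dirDeriv y (zonalPoly y l k) * Y) = 0 := by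
      rcases k with _ | k
      · simp [zonalPoly]
      · rw [dirDeriv_zonalPoly hy, smul_mul_assoc, map_smul,
          sphIntL_mul_eq_zero hd (hz k) (hzl k) hY hYl (by omega), smul_zero]
    rw [Derivation.leibniz, map_add, smul_eq_mul, smul_eq_mul, mul_comm Y, h3, add_zero] at h2
    have h4 := ih (dirDeriv y Y) (isHomogeneous_dirDeriv hY y) (by
      rw [lap_dirDeriv, hYl, map_zero])
    rw [polyEval_dirDeriv_self hY, ← h2] at h4
    have hdl : (d : ℝ) = 2 * l + 2 := by rw [hl]; ring
    rw [hdl] at h4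
    push_cast at h4 ⊢
    have h5 : ((k : ℝ) + 1) * ((l + (k + 1)) * sphIntL d (zonalPoly y l (k + 1) * Y)) =
        ((k : ℝ) + 1) * ((sphMeasure d).real Set.univ * l * polyEval y Y) := by
      rw [mul_left_comm, h1]
      linear_combination h4
    exact mul_left_cancel₀ (by positivity) h5

/-- The `n`-th Taylor coefficient at the origin. -/
def taylorCoef (n : ℕ) (f : ℂ → ℂ) : ℂ := iteratedDeriv n f 0 / n.factorial

lemma contDiffAt_origin {f : ℂ → ℂ} (hf : DifferentiableOn ℂ f (ball 0 1)) (n : WithTop ℕ∞) :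
    ContDiffAt ℂ n f 0 :=
  (hf.analyticAt (isOpen_ball.mem_nhds (mem_ball_self one_pos))).contDiffAt

lemma taylorCoef_congr {f g : ℂ → ℂ} (h : ∀ r ∈ ball (0 : ℂ) 1, f r = g r) (n : ℕ) :
    taylorCoef n f = taylorCoef n g := by
  rw [taylorCoef, taylorCoef, Filter.EventuallyEq.iteratedDeriv_eq n]
  filter_upwards [isOpen_ball.mem_nhds (mem_ball_self one_pos)] using h

lemma taylorCoef_add {f g : ℂ → ℂ} (hf : DifferentiableOn ℂ f (ball 0 1))
    (hg : DifferentiableOn ℂ g (ball 0 1)) (n : ℕ) :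
    taylorCoef n (fun r => f r + g r) = taylorCoef n f + taylorCoef n g := by
  rw [taylorCoef, iteratedDeriv_fun_add (contDiffAt_origin hf _) (contDiffAt_origin hg _), add_div]
  rfl

lemma taylorCoef_const_mul (c : ℂ) (f : ℂ → ℂ) (n : ℕ) :
    taylorCoef n (fun r => c * f r) = c * taylorCoef n f := by
  rw [taylorCoef, iteratedDeriv_const_mul_field, mul_div_assoc]
  rfl

lemma taylorCoef_mul {f g : ℂ → ℂ} (hf : DifferentiableOn ℂ f (ball 0 1))
    (hg : DifferentiableOn ℂ g (ball 0 1)) (n : ℕ) :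
    taylorCoef n (fun r => f r * g r) =
      ∑ k ∈ Finset.range (n + 1), taylorCoef (n - k) f * taylorCoef k g := by
  rw [← Finset.sum_range_reflect, taylorCoef,
    iteratedDeriv_fun_mul (contDiffAt_origin hf _) (contDiffAt_origin hg _), Finset.sum_div]
  refine Finset.sum_congr rfl fun k hk => ?_
  have hk : k ≤ n := by simpa [Nat.lt_succ_iff] using hk
  rw [show n - (n + 1 - 1 - k) = k by omega, show n + 1 - 1 - k = n - k by omega,
    taylorCoef, taylorCoef, Nat.cast_choose ℂ hk]
  have h1 : (k.factorial : ℂ) ≠ 0 := by exact_mod_cast k.factorial_ne_zero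
  have h2 : ((n - k).factorial : ℂ) ≠ 0 := by exact_mod_cast (n - k).factorial_ne_zero
  have h3 : (n.factorial : ℂ) ≠ 0 := by exact_mod_cast n.factorial_ne_zero
  field_simp

lemma taylorCoef_deriv (f : ℂ → ℂ) (n : ℕ) :
    taylorCoef n (deriv f) = (n + 1) * taylorCoef (n + 1) f := by
  rw [taylorCoef, taylorCoef, iteratedDeriv_succ', Nat.factorial_succ]
  have h3 : (n.factorial : ℂ) ≠ 0 := by exact_mod_cast n.factorial_ne_zero
  have h4 : (n : ℂ) + 1 ≠ 0 := by exact_mod_cast n.succ_ne_zero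
  push_cast
  field_simp

lemma taylorCoef_zero (f : ℂ → ℂ) : taylorCoef 0 f = f 0 := by
  simp [taylorCoef]

lemma taylorCoef_zero_mul_id (f : ℂ → ℂ) :
    taylorCoef 0 (fun r => r * f r) = 0 := by
  simp [taylorCoef]

lemma taylorCoef_succ_mul_id {f : ℂ → ℂ} (hf : DifferentiableOn ℂ f (ball 0 1)) (n : ℕ) :
    taylorCoef (n + 1) (fun r => r * f r) = taylorCoef n f := by
  rw [taylorCoef_mul (f := fun r : ℂ => r) differentiableOn_id hf]
  have h : ∀ k, taylorCoef k (fun r : ℂ => r) = if k = 1 then 1 else 0 := by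
    intro k
    rcases k with _ | _ | k
    · simp [taylorCoef]
    · simp [taylorCoef]
    · rw [taylorCoef, iteratedDeriv_succ', iteratedDeriv_succ']
      simp
  rw [Finset.sum_eq_single n]
  · rw [h]; simp
  · intro b hb hbn
    rw [h, if_neg, zero_mul]
    simp at hb
    omega
  · simp

lemma norm_taylorCoef_le {f : ℂ → ℂ} (hf : DifferentiableOn ℂ f (ball 0 1)) {ρ : ℝ} (h0 : 0 < ρ)
    (h1 : ρ < 1) (n : ℕ) : ‖taylorCoef n f‖ ≤
      ((2 * Real.pi)⁻¹ * ∫ θ : ℝ in 0..2 * Real.pi, ‖f (circleMap 0 ρ θ)‖) * ρ⁻¹ ^ n := by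
  have h2 : DifferentiableOn ℂ f (closedBall 0 ρ) := hf.mono (closedBall_subset_ball h1)
  have h3 : HasFPowerSeriesOnBall f (cauchyPowerSeries f 0 ρ) 0 (ENNReal.ofReal ρ) := by
    have := DifferentiableOn.hasFPowerSeriesOnBall (R := ⟨ρ, h0.le⟩) h2 h0
    rw [ENNReal.ofReal, Real.toNNReal_of_nonneg h0.le]
    exact this
  have h4 := h3.factorial_smul 1 n
  rw [iteratedFDeriv_apply_eq_iteratedDeriv_mul_prod, Finset.prod_const_one, one_smul] at h4
  have h5 : taylorCoef n f = cauchyPowerSeries f 0 ρ n (fun _ => 1) := by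
    have h6 : (n.factorial : ℂ) ≠ 0 := by exact_mod_cast n.factorial_ne_zero
    rw [taylorCoef, ← h4, nsmul_eq_mul]
    field_simp
  rw [h5]
  refine ((cauchyPowerSeries f 0 ρ n).le_opNorm _).trans ?_
  simp only [norm_one, Finset.prod_const_one, mul_one]
  have := norm_cauchyPowerSeries_le f 0 ρ n
  rwa [abs_of_pos h0] at this

lemma re_one_sub_mul_pos {w r : ℂ} (hw : ‖w‖ = 1) (hr : r ∈ ball (0 : ℂ) 1) :
    0 < (1 - w * r).re := by
  have h1 : ‖w * r‖ < 1 := by simpa [hw] using hr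
  have h2 := (Complex.re_le_norm (w * r)).trans_lt h1
  simpa using h2

/-- The generating function of the Gegenbauer polynomials at `t = Re w`, `‖w‖ = 1`. -/
def gegGen (l : ℝ) (w r : ℂ) : ℂ :=
  (1 - w * r) ^ (-l : ℂ) * (1 - (starRingEnd ℂ) w * r) ^ (-l : ℂ)

lemma hasDerivAt_one_sub_cpow {w r : ℂ} (hw : ‖w‖ = 1) (hr : r ∈ ball (0 : ℂ) 1) (c : ℂ) :
    HasDerivAt (fun r : ℂ => (1 - w * r) ^ c) (-(c * w) / (1 - w * r) * (1 - w * r) ^ c) r := by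
  have hp := re_one_sub_mul_pos hw hr
  have hne : (1 - w * r) ≠ 0 := fun h => by simp [h] at hp
  have h1 : HasDerivAt (fun r : ℂ => 1 - w * r) (-w) r := by
    simpa using ((hasDerivAt_id r).const_mul w).const_sub 1
  refine (h1.cpow_const (c := c) (Or.inl hp)).congr_deriv ?_
  rw [Complex.cpow_sub _ _ hne, Complex.cpow_one]
  field_simp

lemma one_sub_mul_conj {w : ℂ} (hw : ‖w‖ = 1) (r : ℂ) :
    (1 - w * r) * (1 - (starRingEnd ℂ) w * r) = 1 - 2 * w.re * r + r ^ 2 := by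
  have h1 : w * (starRingEnd ℂ) w = 1 := by
    rw [Complex.mul_conj, Complex.normSq_eq_norm_sq, hw]; simp
  have h2 : w + (starRingEnd ℂ) w = 2 * w.re := by rw [Complex.add_conj]; push_cast; ring
  linear_combination r ^ 2 * h1 - r * h2

lemma gegPoly_ne_zero {w r : ℂ} (hw : ‖w‖ = 1) (hr : r ∈ ball (0 : ℂ) 1) :
    1 - 2 * w.re * r + r ^ 2 ≠ 0 := by
  rw [← one_sub_mul_conj hw]
  refine mul_ne_zero (fun h => ?_) (fun h => ?_)
  · simpa [h] using re_one_sub_mul_pos hw hr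
  · simpa [h] using re_one_sub_mul_pos (w := (starRingEnd ℂ) w) (by simpa using hw) hr

lemma hasDerivAt_gegGen (l : ℝ) {w r : ℂ} (hw : ‖w‖ = 1) (hr : r ∈ ball (0 : ℂ) 1) :
    HasDerivAt (gegGen l w) (2 * l * (w.re - r) / (1 - 2 * w.re * r + r ^ 2) * gegGen l w r) r := by
  have hw' : ‖(starRingEnd ℂ) w‖ = 1 := by simpa using hw
  have hn := gegPoly_ne_zero hw hr
  refine ((hasDerivAt_one_sub_cpow hw hr (-l)).mul
    (hasDerivAt_one_sub_cpow hw' hr (-l))).congr_deriv ?_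
  rw [← one_sub_mul_conj hw] at hn ⊢
  have h1 : (1 - w * r) ≠ 0 := left_ne_zero_of_mul hn
  have h2 : (1 - (starRingEnd ℂ) w * r) ≠ 0 := right_ne_zero_of_mul hn
  have h3 : w + (starRingEnd ℂ) w = 2 * w.re := by rw [Complex.add_conj]; push_cast; ring
  have h4 : w * (starRingEnd ℂ) w = 1 := by
    rw [Complex.mul_conj, Complex.normSq_eq_norm_sq, hw]; simp
  have h5 : (1 - r * (starRingEnd ℂ) w) ≠ 0 := by rwa [mul_comm r]
  rw [gegGen]
  generalize (1 - w * r) ^ (-l : ℂ) = A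
  generalize (1 - (starRingEnd ℂ) w * r) ^ (-l : ℂ) = B
  field_simp
  linear_combination (l * h3 - 2 * l * r * h4) * (A * B)

lemma taylorCoef_gegGen (l : ℝ) {w : ℂ} (hw : ‖w‖ = 1) (n : ℕ) :
    taylorCoef n (gegGen l w) = geg l w.re n := by
  have hd : DifferentiableOn ℂ (gegGen l w) (ball 0 1) := fun r hr =>
    (hasDerivAt_gegGen l hw hr).differentiableAt.differentiableWithinAt
  have hd' : DifferentiableOn ℂ (deriv (gegGen l w)) (ball 0 1) := hd.deriv isOpen_ball
  -- Taylor coefficients of the differential equation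
  have hode : ∀ n, taylorCoef n (fun r => deriv (gegGen l w) r + (-2 * w.re) *
      (r * deriv (gegGen l w) r) + r * (r * deriv (gegGen l w) r)) =
      taylorCoef n (fun r => (2 * l * w.re) * gegGen l w r + (-2 * l) * (r * gegGen l w r)) := by
    intro n
    refine taylorCoef_congr (fun r hr => ?_) n
    rw [(hasDerivAt_gegGen l hw hr).deriv]
    have hn := gegPoly_ne_zero hw hr
    field_simp
    ring
  have hr1 : DifferentiableOn ℂ (fun r : ℂ => r) (ball 0 1) := differentiableOn_id
  have hd1 : DifferentiableOn ℂ (fun r => r * gegGen l w r) (ball 0 1) := hr1.mul hd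
  have hd1' : DifferentiableOn ℂ (fun r => r * deriv (gegGen l w) r) (ball 0 1) := hr1.mul hd'
  have hd2' : DifferentiableOn ℂ (fun r => r * (r * deriv (gegGen l w) r)) (ball 0 1) :=
    hr1.mul hd1'
  have hexp : ∀ n, taylorCoef n (deriv (gegGen l w)) + (-2 * w.re) *
      taylorCoef n (fun r => r * deriv (gegGen l w) r) +
      taylorCoef n (fun r => r * (r * deriv (gegGen l w) r)) =
      (2 * l * w.re) * taylorCoef n (gegGen l w) + (-2 * l) *
        taylorCoef n (fun r => r * gegGen l w r) := by
    intro n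
    have := hode n
    rw [taylorCoef_add (hd'.fun_add (hd1'.const_mul _)) hd2',
      taylorCoef_add hd' (hd1'.const_mul _), taylorCoef_const_mul,
      taylorCoef_add (hd.const_mul _) (hd1.const_mul _), taylorCoef_const_mul,
      taylorCoef_const_mul] at this
    exact this
  have h0 : taylorCoef 0 (gegGen l w) = 1 := by rw [taylorCoef_zero]; simp [gegGen]
  induction n using Nat.twoStepInduction with
  | zero => rw [h0]; simp [geg]
  | one =>
    have := hexp 0
    simp only [taylorCoef_zero_mul_id, taylorCoef_deriv, h0] at this
    simp only [geg]
    push_cast at this ⊢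
    linear_combination this
  | more n h1 h2 =>
    have := hexp (n + 1)
    rw [taylorCoef_succ_mul_id hd', taylorCoef_succ_mul_id hd1',
      taylorCoef_succ_mul_id hd, taylorCoef_deriv, taylorCoef_deriv] at this
    have h3 : taylorCoef n (fun r => r * deriv (gegGen l w) r) = n * taylorCoef n (gegGen l w) := by
      rcases n with _ | n
      · rw [taylorCoef_zero_mul_id]; simp
      · rw [taylorCoef_succ_mul_id hd', taylorCoef_deriv]; push_cast; ring
    rw [h3, h1, h2] at this
    have hne : ((n : ℂ) + 2) ≠ 0 := by exact_mod_cast (n + 1).succ_ne_zero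
    rw [geg]
    push_cast at this ⊢
    apply mul_left_cancel₀ hne
    rw [← mul_assoc, mul_one_div_cancel hne]
    linear_combination this

/-- The Taylor coefficients of `(1 - r²)^z`. -/
def sqCoef (z : ℂ) : ℕ → ℂ
  | 0 => 1
  | 1 => 0
  | j + 2 => ((j : ℂ) - 2 * z) / (j + 2) * sqCoef z j

lemma re_one_sub_sq_pos {r : ℂ} (hr : r ∈ ball (0 : ℂ) 1) : 0 < (1 - r ^ 2).re := by
  have h1 : ‖r ^ 2‖ < 1 := by
    rw [norm_pow]
    exact pow_lt_one₀ (norm_nonneg _) (by simpa using hr) (by norm_num)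
  have h2 := (Complex.re_le_norm (r ^ 2)).trans_lt h1
  rw [Complex.sub_re, Complex.one_re]
  linarith

lemma hasDerivAt_one_sub_sq_cpow {r : ℂ} (hr : r ∈ ball (0 : ℂ) 1) (z : ℂ) :
    HasDerivAt (fun r : ℂ => (1 - r ^ 2) ^ z) (-2 * z * r / (1 - r ^ 2) * (1 - r ^ 2) ^ z) r := by
  have hp := re_one_sub_sq_pos hr
  have hne : (1 - r ^ 2) ≠ 0 := fun h => by simp [h] at hp
  have h1 : HasDerivAt (fun r : ℂ => 1 - r ^ 2) (-(2 * r)) r := by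
    simpa using ((hasDerivAt_id r).pow 2).const_sub 1
  refine (h1.cpow_const (c := z) (Or.inl hp)).congr_deriv ?_
  rw [Complex.cpow_sub _ _ hne, Complex.cpow_one]
  field_simp

lemma differentiableOn_one_sub_sq_cpow (z : ℂ) :
    DifferentiableOn ℂ (fun r : ℂ => (1 - r ^ 2) ^ z) (ball 0 1) := fun _ hr =>
  (hasDerivAt_one_sub_sq_cpow hr z).differentiableAt.differentiableWithinAt

lemma taylorCoef_one_sub_sq_cpow (z : ℂ) (n : ℕ) :
    taylorCoef n (fun r : ℂ => (1 - r ^ 2) ^ z) = sqCoef z n := by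
  set E := fun r : ℂ => (1 - r ^ 2) ^ z with hE
  have hd : DifferentiableOn ℂ E (ball 0 1) := differentiableOn_one_sub_sq_cpow z
  have hd' : DifferentiableOn ℂ (deriv E) (ball 0 1) := hd.deriv isOpen_ball
  have hr1 : DifferentiableOn ℂ (fun r : ℂ => r) (ball 0 1) := differentiableOn_id
  have hd1 : DifferentiableOn ℂ (fun r => r * E r) (ball 0 1) := hr1.mul hd
  have hd1' : DifferentiableOn ℂ (fun r => r * deriv E r) (ball 0 1) := hr1.mul hd'
  have hd2' : DifferentiableOn ℂ (fun r => r * (r * deriv E r)) (ball 0 1) :=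
    hr1.mul hd1'
  have hexp : ∀ n, taylorCoef n (deriv E) =
      taylorCoef n (fun r => r * (r * deriv E r)) + (-2 * z) * taylorCoef n (fun r => r * E r) := by
    intro n
    rw [← taylorCoef_const_mul, ← taylorCoef_add hd2' (hd1.const_mul _)]
    refine taylorCoef_congr (fun r hr => ?_) n
    have hp := re_one_sub_sq_pos hr
    have hne : (1 - r ^ 2) ≠ 0 := fun h => by simp [h] at hp
    rw [(hasDerivAt_one_sub_sq_cpow hr z).deriv]
    field_simp
    ring
  induction n using Nat.twoStepInduction with
  | zero => rw [taylorCoef_zero]; simp [E, sqCoef]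
  | one =>
    have := hexp 0
    simp only [taylorCoef_zero_mul_id, taylorCoef_deriv] at this
    simpa [sqCoef] using this
  | more n h1 _ =>
    have := hexp (n + 1)
    rw [taylorCoef_succ_mul_id hd1', taylorCoef_succ_mul_id hd, taylorCoef_deriv] at this
    have h3 : taylorCoef n (fun r => r * deriv E r) = n * taylorCoef n E := by
      rcases n with _ | n
      · rw [taylorCoef_zero_mul_id]; simp
      · rw [taylorCoef_succ_mul_id hd', taylorCoef_deriv]; push_cast; ring
    rw [h3, h1] at this
    have hne : ((n : ℂ) + 2) ≠ 0 := by exact_mod_cast (n + 1).succ_ne_zero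
    rw [sqCoef]
    push_cast at this
    apply mul_left_cancel₀ hne
    rw [← mul_assoc, mul_div_cancel₀ _ hne]
    linear_combination this

/-- The analytic family of kernels. -/
def kernelFam (l : ℝ) (n : ℕ) (z : ℂ) (t : ℝ) : ℂ :=
  ∑ k ∈ Finset.range (n + 1), sqCoef z (n - k) * (((k + l) / l * geg l t k : ℝ) : ℂ)

/-- The generating function of the analytic family of kernels. -/
def kernelGen (l : ℝ) (z w r : ℂ) : ℂ :=
  (1 - r ^ 2) ^ z * ((1 - r ^ 2) / (1 - 2 * w.re * r + r ^ 2) * gegGen l w r)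

lemma differentiableOn_gegGen (l : ℝ) {w : ℂ} (hw : ‖w‖ = 1) :
    DifferentiableOn ℂ (gegGen l w) (ball 0 1) := fun _ hr =>
  (hasDerivAt_gegGen l hw hr).differentiableAt.differentiableWithinAt

lemma differentiableOn_kernelGen (l : ℝ) (z : ℂ) {w : ℂ} (hw : ‖w‖ = 1) :
    DifferentiableOn ℂ (kernelGen l z w) (ball 0 1) := by
  refine (differentiableOn_one_sub_sq_cpow z).mul (.mul (.div ?_ ?_ ?_)
    (differentiableOn_gegGen l hw))
  · fun_prop
  · fun_prop
  · exact fun r hr => gegPoly_ne_zero hw hr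

lemma taylorCoef_kernelGen {l : ℝ} (hl : 0 < l) (z : ℂ) {w : ℂ} (hw : ‖w‖ = 1) (n : ℕ) :
    taylorCoef n (kernelGen l z w) = kernelFam l n z w.re := by
  have hd := differentiableOn_gegGen l hw
  have hd' : DifferentiableOn ℂ (deriv (gegGen l w)) (ball 0 1) := hd.deriv isOpen_ball
  have hr1 : DifferentiableOn ℂ (fun r : ℂ => r) (ball 0 1) := differentiableOn_id
  have hd1' : DifferentiableOn ℂ (fun r => r * deriv (gegGen l w) r) (ball 0 1) := hr1.mul hd'
  have hl' : (l : ℂ) ≠ 0 := by exact_mod_cast hl.ne'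
  have h1 : taylorCoef n (kernelGen l z w) = taylorCoef n (fun r => (1 - r ^ 2) ^ z *
      (gegGen l w r + (1 / l) * (r * deriv (gegGen l w) r))) := by
    refine taylorCoef_congr (fun r hr => ?_) n
    have hn := gegPoly_ne_zero hw hr
    rw [kernelGen, (hasDerivAt_gegGen l hw hr).deriv]
    congr 1
    generalize hq : 1 - 2 * w.re * r + r ^ 2 = q at hn ⊢
    field_simp
    linear_combination gegGen l w r * hq
  rw [h1, taylorCoef_mul (differentiableOn_one_sub_sq_cpow z) (hd.fun_add (hd1'.const_mul _)),
    kernelFam]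
  refine Finset.sum_congr rfl fun k _ => ?_
  rw [taylorCoef_one_sub_sq_cpow, taylorCoef_add hd (hd1'.const_mul _), taylorCoef_const_mul]
  have h3 : taylorCoef k (fun r => r * deriv (gegGen l w) r) = k * taylorCoef k (gegGen l w) := by
    rcases k with _ | k
    · rw [taylorCoef_zero_mul_id]; simp
    · rw [taylorCoef_succ_mul_id hd', taylorCoef_deriv]; push_cast; ring
  rw [h3, taylorCoef_gegGen l hw]
  push_cast
  field_simp
  ring

lemma norm_cpow_ofReal_of_re_pos {a : ℂ} (ha : 0 < a.re) (s : ℝ) : ‖a ^ (s : ℂ)‖ = ‖a‖ ^ s := by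
  have : a ≠ 0 := fun h => by simp [h] at ha
  rw [Complex.norm_cpow_of_ne_zero this]
  simp

lemma norm_cpow_le_of_re_pos {a : ℂ} (ha : 0 < a.re) (z : ℂ) :
    ‖a ^ z‖ ≤ Real.exp (Real.pi / 2 * |z.im|) * ‖a‖ ^ z.re := by
  have : a ≠ 0 := fun h => by simp [h] at ha
  rw [Complex.norm_cpow_of_ne_zero this, div_eq_mul_inv, ← Real.exp_neg, mul_comm]
  gcongr
  have h1 : |a.arg| ≤ Real.pi / 2 := Complex.abs_arg_le_pi_div_two_iff.2 ha.le
  calc -(a.arg * z.im) ≤ |a.arg * z.im| := neg_le_abs _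
    _ = |a.arg| * |z.im| := abs_mul _ _
    _ ≤ _ := by gcongr

lemma norm_kernelGen_le {l : ℝ} (hl : 0 < l) {z : ℂ} (hz : z.re = l) {w r : ℂ} (hw : ‖w‖ = 1)
    (hr : r ∈ ball (0 : ℂ) 1) :
    ‖kernelGen l z w r‖ ≤ Real.exp (Real.pi / 2 * |z.im|) * (2 ^ (l + 1) *
      (‖1 - w * r‖ ^ (-(l + 1)) + ‖1 - (starRingEnd ℂ) w * r‖ ^ (-(l + 1)))) := by
  have hw' : ‖(starRingEnd ℂ) w‖ = 1 := by simpa using hw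
  have ha := re_one_sub_mul_pos hw hr
  have hb := re_one_sub_mul_pos hw' hr
  have hE := norm_cpow_le_of_re_pos (re_one_sub_sq_pos hr) z
  have hrn : ‖r‖ ≤ 1 := by
    have : ‖r‖ < 1 := by simpa using hr
    exact this.le
  have h4 : w * (starRingEnd ℂ) w = 1 := by
    rw [Complex.mul_conj, Complex.normSq_eq_norm_sq, hw]; simp
  have hab : ‖1 - r ^ 2‖ ≤ ‖1 - w * r‖ + ‖1 - (starRingEnd ℂ) w * r‖ := by
    have h5 : (1 - r ^ 2) = (1 / 2) * ((1 - w * r) * (1 + (starRingEnd ℂ) w * r) +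
        (1 - (starRingEnd ℂ) w * r) * (1 + w * r)) := by
      linear_combination (r ^ 2) * h4
    have h6 : ∀ v : ℂ, ‖v‖ = 1 → ‖1 + v * r‖ ≤ 2 := by
      intro v hv
      refine (norm_add_le _ _).trans ?_
      rw [norm_one, norm_mul, hv]
      linarith
    calc ‖1 - r ^ 2‖ ≤ 1 / 2 * (‖1 - w * r‖ * 2 + ‖1 - (starRingEnd ℂ) w * r‖ * 2) := by
          rw [h5, norm_mul]
          simp only [one_div, norm_inv, Complex.norm_ofNat]
          gcongr
          refine (norm_add_le _ _).trans ?_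
          rw [norm_mul, norm_mul]
          gcongr
          · exact h6 _ hw'
          · exact h6 _ hw
      _ = _ := by ring
  have ha0 : 0 < ‖1 - w * r‖ := norm_pos_iff.2 fun h => by simp [h] at ha
  have hb0 : 0 < ‖1 - (starRingEnd ℂ) w * r‖ := norm_pos_iff.2 fun h => by simp [h] at hb
  have hs0 : 0 < ‖1 - r ^ 2‖ := norm_pos_iff.2 fun h => by
    have := re_one_sub_sq_pos hr
    simp [h] at this
  rw [kernelGen, gegGen, norm_mul, norm_mul, norm_mul, norm_div, ← one_sub_mul_conj hw, norm_mul,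
    ← Complex.ofReal_neg, norm_cpow_ofReal_of_re_pos ha, norm_cpow_ofReal_of_re_pos hb]
  generalize ‖1 - w * r‖ = a at *
  generalize ‖1 - (starRingEnd ℂ) w * r‖ = b at *
  generalize ‖1 - r ^ 2‖ = s at *
  rw [hz] at hE
  calc _ ≤ (Real.exp (Real.pi / 2 * |z.im|) * s ^ l) * (s / (a * b) * (a ^ (-l) * b ^ (-l))) := by
        gcongr
    _ = Real.exp (Real.pi / 2 * |z.im|) * (s ^ (l + 1) * (a ^ (-(l + 1)) * b ^ (-(l + 1)))) := by
        rw [neg_add, Real.rpow_add ha0, Real.rpow_add hb0, Real.rpow_add hs0,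
          Real.rpow_neg_one, Real.rpow_neg_one, Real.rpow_one]
        field_simp
    _ ≤ _ := by
        refine mul_le_mul_of_nonneg_left ?_ (Real.exp_pos _).le
        wlog h : a ≤ b generalizing a b
        · rw [mul_comm (a ^ _), add_comm (a ^ _)]
          exact this b hb0 a ha0 (by linarith) (le_of_not_ge h)
        have h1 : s ≤ 2 * b := by linarith
        calc s ^ (l + 1) * (a ^ (-(l + 1)) * b ^ (-(l + 1)))
            ≤ (2 * b) ^ (l + 1) * (a ^ (-(l + 1)) * b ^ (-(l + 1))) := by gcongr
          _ = 2 ^ (l + 1) * a ^ (-(l + 1)) := by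
            rw [Real.mul_rpow (by norm_num) hb0.le, Real.rpow_neg hb0.le]
            have : b ^ (l + 1) ≠ 0 := (Real.rpow_pos_of_pos hb0 _).ne'
            field_simp
          _ ≤ _ := by
            gcongr
            have := Real.rpow_pos_of_pos hb0 (-(l + 1))
            linarith

lemma norm_one_sub_circleMap_ge {ρ φ : ℝ} (h0 : 1 / 2 ≤ ρ) (h1 : ρ < 1) (hφ : |φ| ≤ Real.pi) :
    (1 - ρ + |φ|) / Real.pi ≤ ‖1 - circleMap 0 ρ φ‖ := by
  have hpi := Real.pi_pos
  have hn : ‖1 - circleMap 0 ρ φ‖ ^ 2 = (1 - ρ) ^ 2 + 2 * ρ * (1 - Real.cos φ) := by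
    rw [← Complex.normSq_eq_norm_sq, Complex.normSq_apply]
    simp only [circleMap, zero_add, Complex.sub_re, Complex.one_re, Complex.sub_im,
      Complex.one_im, Complex.re_ofReal_mul, Complex.im_ofReal_mul, Complex.exp_ofReal_mul_I_re,
      Complex.exp_ofReal_mul_I_im]
    linear_combination ρ ^ 2 * Real.sin_sq_add_cos_sq φ
  have hc := Real.cos_le_one_sub_mul_cos_sq hφ
  have hc2 : 2 / Real.pi ^ 2 * φ ^ 2 ≤ 2 * ρ * (1 - Real.cos φ) := by
    nlinarith [Real.cos_le_one φ]
  refine (sq_le_sq₀ (by have := abs_nonneg φ; have : 0 ≤ 1 - ρ := by linarith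
                        positivity) (norm_nonneg _)).1 ?_
  rw [hn, div_pow]
  have h3 : (1 - ρ) ^ 2 ≥ 2 / Real.pi ^ 2 * (1 - ρ) ^ 2 := by
    have : 2 / Real.pi ^ 2 ≤ 1 := by
      rw [div_le_one (by positivity)]
      nlinarith [Real.pi_gt_three]
    nlinarith [sq_nonneg (1 - ρ)]
  calc (1 - ρ + |φ|) ^ 2 / Real.pi ^ 2 ≤ (2 * ((1 - ρ) ^ 2 + |φ| ^ 2)) / Real.pi ^ 2 := by
        gcongr
        nlinarith [sq_nonneg (1 - ρ - |φ|)]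
    _ = 2 / Real.pi ^ 2 * (1 - ρ) ^ 2 + 2 / Real.pi ^ 2 * φ ^ 2 := by rw [sq_abs]; ring
    _ ≤ _ := by linarith

lemma one_sub_circleMap_ne_zero {ρ : ℝ} (h0 : 0 < ρ) (h1 : ρ < 1) (φ : ℝ) :
    1 - circleMap 0 ρ φ ≠ 0 := by
  intro h
  have : ‖circleMap 0 ρ φ‖ = 1 := by rw [← sub_eq_zero.1 h]; simp
  simp [abs_of_pos h0] at this
  linarith

lemma continuous_norm_one_sub_circleMap_rpow {ρ : ℝ} (h0 : 0 < ρ) (h1 : ρ < 1) (s : ℝ) :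
    Continuous fun φ : ℝ => ‖1 - circleMap 0 ρ φ‖ ^ s := by
  refine Continuous.rpow_const ?_ fun φ => Or.inl ?_
  · exact (continuous_const.sub (continuous_circleMap 0 ρ)).norm
  · exact (norm_pos_iff.2 (one_sub_circleMap_ne_zero h0 h1 φ)).ne'

lemma integral_norm_one_sub_circleMap_le {l ρ : ℝ} (hl : 0 < l) (h0 : 1 / 2 ≤ ρ) (h1 : ρ < 1) :
    ∫ φ in (0 : ℝ)..2 * Real.pi, ‖1 - circleMap 0 ρ φ‖ ^ (-(l + 1)) ≤
      2 * Real.pi ^ (l + 1) / l * (1 - ρ) ^ (-l) := by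
  have hpi := Real.pi_pos
  have hρ : 0 < ρ := by linarith
  set F : ℝ → ℝ := fun φ => ‖1 - circleMap 0 ρ φ‖ ^ (-(l + 1)) with hF
  have hc : Continuous F := continuous_norm_one_sub_circleMap_rpow hρ h1 _
  have hper : Function.Periodic F (2 * Real.pi) := fun φ => by
    simp only [hF]
    rw [periodic_circleMap]
  have heven : ∀ φ, F (-φ) = F φ := by
    intro φ
    simp only [hF]
    congr 1
    rw [← Complex.norm_conj]
    congr 1
    simp [circleMap, ← Complex.exp_conj]
  have e1 : ∫ φ in (0 : ℝ)..2 * Real.pi, F φ = ∫ φ in (-Real.pi)..Real.pi, F φ := by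
    have := hper.intervalIntegral_add_eq 0 (-Real.pi)
    rw [zero_add] at this
    rw [this]
    congr 1
    ring
  have e2 : ∫ φ in (-Real.pi)..0, F φ = ∫ φ in (0 : ℝ)..Real.pi, F φ := by
    have := intervalIntegral.integral_comp_neg (a := 0) (b := Real.pi) F
    rw [neg_zero] at this
    rw [← this]
    simp only [heven]
  rw [e1, ← intervalIntegral.integral_add_adjacent_intervals (hc.intervalIntegrable _ 0)
    (hc.intervalIntegrable _ _), e2]
  have hG : ContinuousOn (fun φ : ℝ => Real.pi ^ (l + 1) * (φ + (1 - ρ)) ^ (-(l + 1)))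
      (Set.uIcc 0 Real.pi) := by
    intro φ hφ
    rw [Set.uIcc_of_le hpi.le] at hφ
    refine ContinuousAt.continuousWithinAt ?_
    refine continuousAt_const.mul (ContinuousAt.rpow_const (by fun_prop) (Or.inl ?_))
    linarith [hφ.1]
  have h2 : ∫ φ in (0 : ℝ)..Real.pi, F φ ≤ ∫ φ in (0 : ℝ)..Real.pi,
      Real.pi ^ (l + 1) * (φ + (1 - ρ)) ^ (-(l + 1)) := by
    refine intervalIntegral.integral_mono_on hpi.le (hc.intervalIntegrable _ _)
      hG.intervalIntegrable fun φ hφ => ?_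
    have h3 := norm_one_sub_circleMap_ge h0 h1 (φ := φ) (by rw [abs_of_nonneg hφ.1]; exact hφ.2)
    rw [abs_of_nonneg hφ.1] at h3
    have h4 : 0 < 1 - ρ + φ := by linarith [hφ.1]
    calc F φ ≤ ((1 - ρ + φ) / Real.pi) ^ (-(l + 1)) :=
          Real.rpow_le_rpow_of_nonpos (by positivity) h3 (by linarith)
      _ = _ := by
          rw [Real.div_rpow h4.le hpi.le, Real.rpow_neg hpi.le, add_comm φ]
          field_simp
  have h3 : ∫ φ in (0 : ℝ)..Real.pi, Real.pi ^ (l + 1) * (φ + (1 - ρ)) ^ (-(l + 1)) ≤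
      Real.pi ^ (l + 1) / l * (1 - ρ) ^ (-l) := by
    rw [intervalIntegral.integral_const_mul,
      intervalIntegral.integral_comp_add_right (fun x : ℝ => x ^ (-(l + 1))), integral_rpow]
    · rw [show -(l + 1) + 1 = -l by ring, zero_add, div_mul_eq_mul_div, ← mul_div_assoc,
        div_neg, ← neg_div]
      gcongr
      rw [← mul_neg, neg_sub]
      gcongr
      have : 0 ≤ (Real.pi + (1 - ρ)) ^ (-l) := Real.rpow_nonneg (by linarith) _
      linarith
    · right
      refine ⟨by linarith, ?_⟩
      rw [Set.uIcc_of_le (by linarith)]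
      rintro ⟨h, -⟩
      linarith
  calc _ ≤ Real.pi ^ (l + 1) / l * (1 - ρ) ^ (-l) + Real.pi ^ (l + 1) / l * (1 - ρ) ^ (-l) :=
        add_le_add (h2.trans h3) (h2.trans h3)
    _ = _ := by ring

lemma integral_norm_one_sub_mul_circleMap {w : ℂ} (hw : ‖w‖ = 1) (ρ s : ℝ) :
    ∫ φ in (0 : ℝ)..2 * Real.pi, ‖1 - w * circleMap 0 ρ φ‖ ^ s =
      ∫ φ in (0 : ℝ)..2 * Real.pi, ‖1 - circleMap 0 ρ φ‖ ^ s := by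
  have h1 : ∀ φ : ℝ, w * circleMap 0 ρ φ = circleMap 0 ρ (φ + w.arg) := by
    intro φ
    have : w = Complex.exp (w.arg * Complex.I) := by
      conv_lhs => rw [← Complex.norm_mul_exp_arg_mul_I w, hw]
      simp
    conv_lhs => rw [this]
    simp only [circleMap, zero_add]
    push_cast
    rw [add_mul, Complex.exp_add]
    ring
  have hper : Function.Periodic (fun φ : ℝ => ‖1 - circleMap 0 ρ φ‖ ^ s) (2 * Real.pi) :=
    fun φ => by simp only; rw [periodic_circleMap]
  simp only [h1]
  rw [intervalIntegral.integral_comp_add_right (fun φ : ℝ => ‖1 - circleMap 0 ρ φ‖ ^ s), zero_add]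
  have := hper.intervalIntegral_add_eq w.arg 0
  rw [zero_add] at this
  rw [← this, add_comm]

/-- Uniform bound for the analytic family on the line `Re z = l`. -/
lemma exists_norm_kernelFam_le {l : ℝ} (hl : 0 < l) : ∃ C : ℝ, 0 < C ∧ ∀ n : ℕ, 1 ≤ n →
    ∀ z : ℂ, z.re = l → ∀ t : ℝ, |t| ≤ 1 →
      ‖kernelFam l n z t‖ ≤ C * (n : ℝ) ^ l * Real.exp (Real.pi / 2 * |z.im|) := by
  have hpi := Real.pi_pos
  refine ⟨(2 * Real.pi)⁻¹ * (2 ^ (l + 1) * (2 * (2 * Real.pi ^ (l + 1) / l))) * 2 ^ l *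
    Real.exp 1, by positivity, fun n hn z hz t ht => ?_⟩
  have hn' : (1 : ℝ) ≤ n := by exact_mod_cast hn
  set w : ℂ := Complex.exp (Real.arccos t * Complex.I) with hw_def
  have hw : ‖w‖ = 1 := Complex.norm_exp_ofReal_mul_I _
  have hwt : w.re = t := by
    rw [hw_def, Complex.exp_ofReal_mul_I_re, Real.cos_arccos (abs_le.1 ht).1 (abs_le.1 ht).2]
  have hw' : ‖(starRingEnd ℂ) w‖ = 1 := by simpa using hw
  set ρ : ℝ := n / (n + 1) with hρ
  have h0 : 1 / 2 ≤ ρ := by rw [hρ, div_le_div_iff₀ (by norm_num) (by positivity)]; linarith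
  have h1 : ρ < 1 := by rw [hρ, div_lt_one (by positivity)]; linarith
  have hρ0 : 0 < ρ := by linarith
  have hball : ∀ φ : ℝ, circleMap 0 ρ φ ∈ ball (0 : ℂ) 1 := by
    intro φ
    simpa [abs_of_pos hρ0] using h1
  rw [← hwt, ← taylorCoef_kernelGen hl z hw]
  refine (norm_taylorCoef_le (differentiableOn_kernelGen l z hw) hρ0 h1 n).trans ?_
  have hcont : ∀ v : ℂ, ‖v‖ = 1 → Continuous fun φ : ℝ =>
      ‖1 - v * circleMap 0 ρ φ‖ ^ (-(l + 1)) := by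
    intro v hv
    refine Continuous.rpow_const ?_ fun φ => Or.inl ?_
    · exact (continuous_const.sub (continuous_const.mul (continuous_circleMap 0 ρ))).norm
    · refine (norm_pos_iff.2 fun h => ?_).ne'
      have := re_one_sub_mul_pos hv (hball φ)
      simp [h] at this
  have h_circle : ∫ φ in (0 : ℝ)..2 * Real.pi, ‖kernelGen l z w (circleMap 0 ρ φ)‖ ≤
      Real.exp (Real.pi / 2 * |z.im|) * (2 ^ (l + 1) *
        (2 * (2 * Real.pi ^ (l + 1) / l * (1 - ρ) ^ (-l)))) := by
    have hk : Continuous fun φ : ℝ => ‖kernelGen l z w (circleMap 0 ρ φ)‖ :=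
      ((differentiableOn_kernelGen l z hw).continuousOn.comp_continuous
        (continuous_circleMap 0 ρ) hball).norm
    have hi := integral_norm_one_sub_circleMap_le hl h0 h1
    calc _ ≤ ∫ φ in (0 : ℝ)..2 * Real.pi, Real.exp (Real.pi / 2 * |z.im|) * (2 ^ (l + 1) *
          (‖1 - w * circleMap 0 ρ φ‖ ^ (-(l + 1)) +
            ‖1 - (starRingEnd ℂ) w * circleMap 0 ρ φ‖ ^ (-(l + 1)))) := by
          refine intervalIntegral.integral_mono_on (by positivity) (hk.intervalIntegrable _ _) ?_
            fun φ _ => norm_kernelGen_le hl hz hw (hball φ)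
          exact (continuous_const.mul (continuous_const.mul
            ((hcont w hw).add (hcont _ hw')))).intervalIntegrable _ _
      _ ≤ _ := by
          rw [intervalIntegral.integral_const_mul, intervalIntegral.integral_const_mul,
            intervalIntegral.integral_add ((hcont w hw).intervalIntegrable _ _)
              ((hcont _ hw').intervalIntegrable _ _),
            integral_norm_one_sub_mul_circleMap hw, integral_norm_one_sub_mul_circleMap hw']
          gcongr
          linarith
  have hδ : (1 - ρ) ^ (-l) ≤ 2 ^ l * (n : ℝ) ^ l := by
    have : 1 - ρ = (n + 1 : ℝ)⁻¹ := by rw [hρ]; field_simp; ring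
    rw [this, Real.inv_rpow (by positivity), Real.rpow_neg (by positivity), inv_inv,
      ← Real.mul_rpow (by norm_num) (by positivity)]
    gcongr
    linarith
  have hρn : ρ⁻¹ ^ n ≤ Real.exp 1 := by
    have h2 : ρ⁻¹ = 1 + 1 / n := by rw [hρ]; field_simp
    have h3 : ρ⁻¹ ≤ Real.exp (1 / n) := by
      rw [h2, add_comm]; exact Real.add_one_le_exp _
    calc ρ⁻¹ ^ n ≤ Real.exp (1 / n) ^ n := by gcongr
      _ = Real.exp 1 := by rw [← Real.exp_nat_mul]; congr 1; field_simp
  calc _ ≤ ((2 * Real.pi)⁻¹ * (Real.exp (Real.pi / 2 * |z.im|) * (2 ^ (l + 1) *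
        (2 * (2 * Real.pi ^ (l + 1) / l * (2 ^ l * (n : ℝ) ^ l)))))) * Real.exp 1 := by
        gcongr
        refine h_circle.trans ?_
        gcongr
    _ = _ := by ring

lemma norm_sqCoef_sq_le {κ : ℝ} (hκ : 1 ≤ κ) (z : ℂ)
    (h : ∀ m : ℝ, 0 ≤ m → |m - z.re| ≤ κ * (m + 1)) :
    ∀ j : ℕ, ‖sqCoef z j‖ ^ 2 ≤ (κ ^ j) ^ 2 * Real.exp (z.im ^ 2 * (2 - 2 / ((j : ℝ) / 2 + 1)))
  | 0 => by simp [sqCoef]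
  | 1 => by rw [sqCoef, norm_zero, zero_pow two_ne_zero]; positivity
  | j + 2 => by
    have ih := norm_sqCoef_sq_le hκ z h j
    set m : ℝ := (j : ℝ) / 2 with hm
    have hm0 : 0 ≤ m := by positivity
    have hfac : ‖((j : ℂ) - 2 * z) / ((j : ℂ) + 2)‖ ^ 2
        = ((m - z.re) ^ 2 + z.im ^ 2) / (m + 1) ^ 2 := by
      have : ((j : ℂ) - 2 * z) / ((j : ℂ) + 2) = ((m : ℂ) - z) / ((m + 1 : ℝ) : ℂ) := by
        have h2 : ((j : ℂ) + 2) ≠ 0 := by exact_mod_cast (by positivity : (j : ℝ) + 2 ≠ 0)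
        have h3 : ((m + 1 : ℝ) : ℂ) ≠ 0 := by exact_mod_cast (by positivity : m + 1 ≠ 0)
        rw [div_eq_div_iff h2 h3, hm]
        push_cast
        ring
      rw [this, norm_div, div_pow, ← Complex.normSq_eq_norm_sq, Complex.normSq_apply,
        Complex.norm_real, Real.norm_eq_abs, sq_abs]
      simp
      ring
    have hf2 : ‖((j : ℂ) - 2 * z) / ((j : ℂ) + 2)‖ ^ 2
        ≤ κ ^ 2 * Real.exp (z.im ^ 2 * (1 / (m + 1) ^ 2)) := by
      rw [hfac, div_le_iff₀ (by positivity)]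
      have h1 : (m - z.re) ^ 2 ≤ (κ * (m + 1)) ^ 2 := by
        rw [← sq_abs]
        gcongr
        exact h m hm0
      have h2 := Real.add_one_le_exp (z.im ^ 2 * (1 / (m + 1) ^ 2))
      have h3 : κ ^ 2 * (z.im ^ 2 * (1 / (m + 1) ^ 2) + 1) * (m + 1) ^ 2
          = κ ^ 2 * z.im ^ 2 + (κ * (m + 1)) ^ 2 := by
        field_simp
      have h4 : z.im ^ 2 ≤ κ ^ 2 * z.im ^ 2 := by
        nlinarith [sq_nonneg z.im, one_le_pow₀ hκ (n := 2)]
      calc _ ≤ κ ^ 2 * (z.im ^ 2 * (1 / (m + 1) ^ 2) + 1) * (m + 1) ^ 2 := by linarith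
        _ ≤ _ := by gcongr
    have hkk : κ ^ j * κ ≤ κ ^ (j + 2) := by
      rw [← pow_succ]; exact pow_le_pow_right₀ hκ (by omega)
    have hexp : z.im ^ 2 * (1 / (m + 1) ^ 2) + z.im ^ 2 * (2 - 2 / (m + 1))
        ≤ z.im ^ 2 * (2 - 2 / (((j + 2 : ℕ) : ℝ) / 2 + 1)) := by
      rw [← mul_add]
      refine mul_le_mul_of_nonneg_left ?_ (sq_nonneg _)
      have : ((j + 2 : ℕ) : ℝ) / 2 + 1 = m + 2 := by push_cast; rw [hm]; ring
      rw [this]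
      have : 2 - 2 / (m + 2) - (1 / (m + 1) ^ 2 + (2 - 2 / (m + 1)))
          = m / ((m + 1) ^ 2 * (m + 2)) := by
        field_simp
        ring
      have h0 : 0 ≤ m / ((m + 1) ^ 2 * (m + 2)) := by positivity
      linarith
    rw [sqCoef, norm_mul, mul_pow]
    calc _ ≤ (κ ^ 2 * Real.exp (z.im ^ 2 * (1 / (m + 1) ^ 2))) *
          ((κ ^ j) ^ 2 * Real.exp (z.im ^ 2 * (2 - 2 / (m + 1)))) := by gcongr
      _ = (κ ^ j * κ) ^ 2 *
          Real.exp (z.im ^ 2 * (1 / (m + 1) ^ 2) + z.im ^ 2 * (2 - 2 / (m + 1))) := by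
        rw [Real.exp_add]; ring
      _ ≤ _ := by gcongr

lemma norm_sqCoef_le {κ : ℝ} (hκ : 1 ≤ κ) (z : ℂ)
    (h : ∀ m : ℝ, 0 ≤ m → |m - z.re| ≤ κ * (m + 1)) (j : ℕ) :
    ‖sqCoef z j‖ ≤ κ ^ j * Real.exp (z.im ^ 2) := by
  refine (sq_le_sq₀ (norm_nonneg _) (by positivity)).1 ((norm_sqCoef_sq_le hκ z h j).trans ?_)
  rw [mul_pow, ← Real.exp_nat_mul]
  have : 0 ≤ 2 / ((j : ℝ) / 2 + 1) := by positivity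
  refine mul_le_mul_of_nonneg_left (Real.exp_le_exp.2 ?_) (by positivity)
  push_cast
  nlinarith [sq_nonneg z.im]

lemma norm_sqCoef_le_of_re_eq_neg_one {z : ℂ} (hz : z.re = -1) (j : ℕ) :
    ‖sqCoef z j‖ ≤ Real.exp (z.im ^ 2) := by
  refine (norm_sqCoef_le le_rfl z (fun m hm => ?_) j).trans_eq (by simp)
  rw [hz, abs_of_nonneg (by linarith)]
  linarith

lemma norm_sqCoef_le_of_mem_strip {l : ℝ} (hl : 0 ≤ l) {z : ℂ} (h1 : -1 ≤ z.re) (h2 : z.re ≤ l)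
    (j : ℕ) : ‖sqCoef z j‖ ≤ (1 + l) ^ j * Real.exp (z.im ^ 2) := by
  refine norm_sqCoef_le (by linarith) z (fun m hm => ?_) j
  rw [abs_le]
  constructor <;> nlinarith [mul_nonneg hl hm]

lemma differentiable_sqCoef : ∀ j : ℕ, Differentiable ℂ fun z => sqCoef z j
  | 0 => by simp only [sqCoef]; fun_prop
  | 1 => by simp only [sqCoef]; fun_prop
  | j + 2 => by
    have := differentiable_sqCoef j
    simp only [sqCoef]
    fun_prop

lemma sqCoef_zero_left : ∀ j : ℕ, sqCoef 0 j = if j = 0 then 1 else 0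
  | 0 => by simp [sqCoef]
  | 1 => by simp [sqCoef]
  | j + 2 => by
    rw [sqCoef, sqCoef_zero_left j]
    by_cases hj : j = 0 <;> simp [hj]

lemma continuous_polyEval_sph {d : ℕ} (P : MvPolynomial (Fin d) ℝ) :
    Continuous fun x : Sph d => polyEval (x : EuclideanSpace ℝ (Fin d)) P :=
  (continuous_polyEval P).comp continuous_subtype_val

lemma memLp_polyEval {d : ℕ} (P : MvPolynomial (Fin d) ℝ) (p : ℝ≥0∞) :
    MemLp (fun x : Sph d => polyEval (x : EuclideanSpace ℝ (Fin d)) P) p (sphMeasure d) := by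
  obtain ⟨C, hC⟩ := (isCompact_range (continuous_polyEval_sph P)).isBounded.exists_norm_le
  exact MemLp.of_bound (continuous_polyEval_sph P).aestronglyMeasurable C
    (.of_forall fun x => hC _ ⟨x, rfl⟩)

lemma toLp_polyEval_mem_Hspace {d k : ℕ} {P : MvPolynomial (Fin d) ℝ} (hP : P.IsHomogeneous k)
    (hPl : lap P = 0) : (memLp_polyEval P 2).toLp _ ∈ Hspace d k :=
  Submodule.subset_span ⟨_, ⟨P, hP, hPl, fun _ => rfl⟩, MemLp.coeFn_toLp _⟩

lemma exists_polyEval_of_mem_Hspace {d k : ℕ} {φ : Lp ℝ 2 (sphMeasure d)}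
    (hφ : φ ∈ Hspace d k) : ∃ P : MvPolynomial (Fin d) ℝ, P.IsHomogeneous k ∧ lap P = 0 ∧
      φ = (memLp_polyEval P 2).toLp _ := by
  suffices h : ∃ P : MvPolynomial (Fin d) ℝ, P.IsHomogeneous k ∧ lap P = 0 ∧
      φ =ᵐ[sphMeasure d] fun x : Sph d => polyEval (x : EuclideanSpace ℝ (Fin d)) P by
    obtain ⟨P, h1, h2, h3⟩ := h
    exact ⟨P, h1, h2, Lp.ext (h3.trans (MemLp.coeFn_toLp _).symm)⟩
  induction hφ using Submodule.span_induction with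
  | mem φ h =>
    obtain ⟨Y, ⟨P, h1, h2, h3⟩, h4⟩ := h
    exact ⟨P, h1, h2, h4.trans (.of_forall h3)⟩
  | zero =>
    refine ⟨0, MvPolynomial.isHomogeneous_zero _ _ _, by simp [lap], ?_⟩
    filter_upwards [Lp.coeFn_zero ℝ 2 (sphMeasure d)] with x hx
    rw [map_zero]
    exact hx
  | add φ ψ _ _ h1 h2 =>
    obtain ⟨P, hP, hPl, hPe⟩ := h1
    obtain ⟨Q, hQ, hQl, hQe⟩ := h2
    refine ⟨P + Q, hP.add hQ, by rw [lap_add, hPl, hQl, add_zero], ?_⟩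
    filter_upwards [Lp.coeFn_add φ ψ, hPe, hQe] with x h1 h2 h3
    rw [h1, map_add, ← h2, ← h3]
    rfl
  | smul c φ _ h =>
    obtain ⟨P, hP, hPl, hPe⟩ := h
    refine ⟨c • P, isHomogeneous_const_smul c hP, by rw [lap_smul, hPl, smul_zero], ?_⟩
    filter_upwards [Lp.coeFn_smul c φ, hPe] with x h1 h2
    rw [h1, polyEval_smul_poly]
    simp [h2]

lemma inner_toLp {d : ℕ} {f g : Sph d → ℝ} (hf : MemLp f 2 (sphMeasure d))
    (hg : MemLp g 2 (sphMeasure d)) :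
    @inner ℝ _ _ (hf.toLp f) (hg.toLp g) = ∫ x, f x * g x ∂(sphMeasure d) := by
  rw [L2.inner_def]
  refine integral_congr_ae ?_
  filter_upwards [hf.coeFn_toLp, hg.coeFn_toLp] with x h1 h2
  simp [h1, h2, mul_comm]

lemma inner_Hspace_eq_zero {d j k : ℕ} (hd : 3 ≤ d) (hjk : j ≠ k) {φ ψ : Lp ℝ 2 (sphMeasure d)}
    (hφ : φ ∈ Hspace d j) (hψ : ψ ∈ Hspace d k) : @inner ℝ _ _ φ ψ = 0 := by
  obtain ⟨P, hP, hPl, rfl⟩ := exists_polyEval_of_mem_Hspace hφ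
  obtain ⟨Q, hQ, hQl, rfl⟩ := exists_polyEval_of_mem_Hspace hψ
  rw [inner_toLp, ← sphIntL_mul_eq_zero hd hP hPl hQ hQl hjk]
  simp [sphIntL, sphInt]

section projection
variable {d : ℕ} {k : ℕ} {T : Lp ℝ 2 (sphMeasure d) → Lp ℝ 2 (sphMeasure d)}

lemma inner_proj_left (hT : IsOrthProjOnto d k T) (F : Lp ℝ 2 (sphMeasure d))
    {G : Lp ℝ 2 (sphMeasure d)} (hG : G ∈ Hspace d k) :
    @inner ℝ _ _ (T F) G = @inner ℝ _ _ F G := by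
  have := (hT F).2 G hG
  rw [inner_sub_left] at this
  linarith

lemma inner_proj_proj (hT : IsOrthProjOnto d k T) (F G : Lp ℝ 2 (sphMeasure d)) :
    @inner ℝ _ _ (T F) (T G) = @inner ℝ _ _ (T F) G := by
  rw [real_inner_comm, inner_proj_left hT G (hT F).1, real_inner_comm]

lemma norm_proj_le (hT : IsOrthProjOnto d k T) (F : Lp ℝ 2 (sphMeasure d)) : ‖T F‖ ≤ ‖F‖ := by
  have h1 := inner_proj_proj hT F F
  rw [real_inner_self_eq_norm_sq] at h1
  have h2 := real_inner_le_norm (T F) F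
  by_contra! h
  nlinarith [norm_nonneg F, norm_nonneg (T F)]

end projection

lemma sum_norm_proj_sq_le {d : ℕ} (hd : 3 ≤ d)
    {proj : ℕ → Lp ℝ 2 (sphMeasure d) → Lp ℝ 2 (sphMeasure d)}
    (hproj : ∀ k, IsOrthProjOnto d k (proj k)) (F : Lp ℝ 2 (sphMeasure d)) (s : Finset ℕ) :
    ∑ k ∈ s, ‖proj k F‖ ^ 2 ≤ ‖F‖ ^ 2 := by
  have h1 : @inner ℝ _ _ F (∑ k ∈ s, proj k F) = ∑ k ∈ s, ‖proj k F‖ ^ 2 := by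
    rw [inner_sum]
    refine Finset.sum_congr rfl fun k _ => ?_
    rw [← inner_proj_left (hproj k) F (hproj k F).1, real_inner_self_eq_norm_sq]
  have h2 : ‖∑ k ∈ s, proj k F‖ ^ 2 = ∑ k ∈ s, ‖proj k F‖ ^ 2 := by
    rw [← real_inner_self_eq_norm_sq, sum_inner]
    refine Finset.sum_congr rfl fun k hk => ?_
    rw [inner_sum, Finset.sum_eq_single k, real_inner_self_eq_norm_sq]
    · exact fun j _ hj => inner_Hspace_eq_zero hd hj.symm (hproj k F).1 (hproj j F).1
    · exact fun h => absurd hk h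
  have h3 := norm_sub_sq_real F (∑ k ∈ s, proj k F)
  rw [h1, h2] at h3
  nlinarith [sq_nonneg ‖F - ∑ k ∈ s, proj k F‖]

/-- The zonal reproducing kernel of `H_k^d`, multiplied by the total mass of the sphere. -/
def zonal (d k : ℕ) (p : Sph d × Sph d) : ℝ :=
  (k + ((d : ℝ) - 2) / 2) / (((d : ℝ) - 2) / 2) * geg (((d : ℝ) - 2) / 2)
    (inner ℝ (p.1 : EuclideanSpace ℝ (Fin d)) (p.2 : EuclideanSpace ℝ (Fin d))) k

lemma continuous_geg (l : ℝ) (k : ℕ) : Continuous fun t => geg l t k := by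
  induction k using Nat.twoStepInduction with
  | zero => simp only [geg]; fun_prop
  | one => simp only [geg]; fun_prop
  | more k h1 h2 => simp only [geg]; fun_prop

lemma continuous_zonal (d k : ℕ) : Continuous (zonal d k) := by
  unfold zonal
  exact continuous_const.mul ((continuous_geg _ k).comp (by fun_prop))

lemma integral_zonal_mul {d k : ℕ} (hd : 3 ≤ d)
    {T : Lp ℝ 2 (sphMeasure d) → Lp ℝ 2 (sphMeasure d)} (hT : IsOrthProjOnto d k T)
    {f : Sph d → ℝ} (hf : MemLp f 2 (sphMeasure d)) {P : MvPolynomial (Fin d) ℝ}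
    (hP : P.IsHomogeneous k) (hPl : lap P = 0)
    (hPf : T (hf.toLp f) = (memLp_polyEval P 2).toLp _) (y : Sph d) :
    ∫ x, zonal d k (x, y) * f x ∂(sphMeasure d) =
      (sphMeasure d).real Set.univ * polyEval (y : EuclideanSpace ℝ (Fin d)) P := by
  set l : ℝ := ((d : ℝ) - 2) / 2 with hl
  have hd' : (3 : ℝ) ≤ d := by exact_mod_cast hd
  have hl0 : 0 < l := by rw [hl]; linarith
  have hy : ‖(y : EuclideanSpace ℝ (Fin d))‖ = 1 := by simp
  have hz := isHomogeneous_zonalPoly (y : EuclideanSpace ℝ (Fin d)) l k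
  have hzl := lap_zonalPoly hy hl k
  have h1 := inner_proj_left hT (hf.toLp f) (toLp_polyEval_mem_Hspace hz hzl)
  rw [hPf, inner_toLp, inner_toLp] at h1
  have h2 := sphIntL_zonalPoly_mul hd hl hy k P hP hPl
  have h3 : sphIntL d (zonalPoly (y : EuclideanSpace ℝ (Fin d)) l k * P) =
      ∫ x : Sph d, polyEval (x : EuclideanSpace ℝ (Fin d)) P *
        polyEval (x : EuclideanSpace ℝ (Fin d)) (zonalPoly (y : EuclideanSpace ℝ (Fin d)) l k)
        ∂(sphMeasure d) := by
    simp [sphIntL, sphInt, mul_comm]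
  rw [h3, h1] at h2
  have h4 : ∀ x : Sph d, zonal d k (x, y) * f x = (k + l) / l * (f x *
      polyEval (x : EuclideanSpace ℝ (Fin d))
        (zonalPoly (y : EuclideanSpace ℝ (Fin d)) l k)) := by
    intro x
    rw [polyEval_zonalPoly, zonal]
    ring
  simp only [h4]
  rw [integral_const_mul, div_mul_eq_mul_div, add_comm (k : ℝ), h2]
  field_simp

lemma integrable_continuous_mul_mul {d : ℕ} {𝕜 : Type*} [RCLike 𝕜]
    {K : Sph d × Sph d → 𝕜} (hK : Continuous K)
    {f g : Sph d → 𝕜} (hf : Integrable f (sphMeasure d)) (hg : Integrable g (sphMeasure d)) :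
    Integrable (fun p => K p * (f p.1 * g p.2)) ((sphMeasure d).prod (sphMeasure d)) := by
  obtain ⟨C, hC⟩ := (isCompact_range hK).isBounded.exists_norm_le
  exact (hf.mul_prod hg).bdd_mul (c := C) hK.aestronglyMeasurable
    (.of_forall fun p => hC _ ⟨p, rfl⟩)

/-- The bilinear form of the zonal kernel is the inner product with the projection. -/
lemma integral_zonal_mul_mul {d k : ℕ} (hd : 3 ≤ d)
    {T : Lp ℝ 2 (sphMeasure d) → Lp ℝ 2 (sphMeasure d)} (hT : IsOrthProjOnto d k T)
    {f g : Sph d → ℝ} (hf : MemLp f 2 (sphMeasure d)) (hg : MemLp g 2 (sphMeasure d)) :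
    ∫ p, zonal d k p * (f p.1 * g p.2) ∂((sphMeasure d).prod (sphMeasure d)) =
      (sphMeasure d).real Set.univ * @inner ℝ _ _ (T (hf.toLp f)) (hg.toLp g) := by
  obtain ⟨P, hP, hPl, hPf⟩ := exists_polyEval_of_mem_Hspace (hT (hf.toLp f)).1
  rw [integral_prod_symm _ (integrable_continuous_mul_mul (continuous_zonal d k)
    (hf.integrable one_le_two) (hg.integrable one_le_two)), hPf, inner_toLp,
    ← integral_const_mul]
  refine integral_congr_ae (.of_forall fun y => ?_)
  have := integral_zonal_mul hd hT hf hP hPl hPf y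
  simp only [← mul_assoc]
  rw [integral_mul_const, this]

/-- The (complex bilinear) form of the `k`-th zonal kernel. -/
def zonalForm (d k : ℕ) (u : Sph d → ℂ) : ℂ :=
  ∫ p, (zonal d k p : ℂ) * (u p.1 * u p.2) ∂((sphMeasure d).prod (sphMeasure d))

lemma norm_zonalForm_le {d k : ℕ} (hd : 3 ≤ d)
    {T : Lp ℝ 2 (sphMeasure d) → Lp ℝ 2 (sphMeasure d)} (hT : IsOrthProjOnto d k T)
    {f g : Sph d → ℝ} (hf : MemLp f 2 (sphMeasure d)) (hg : MemLp g 2 (sphMeasure d)) :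
    ‖zonalForm d k (fun x => (f x : ℂ) + g x * Complex.I)‖ ≤ (sphMeasure d).real Set.univ *
      (‖T (hf.toLp f)‖ ^ 2 + ‖T (hg.toLp g)‖ ^ 2) := by
  set S := (sphMeasure d).real Set.univ with hS
  have hS0 : 0 ≤ S := measureReal_nonneg
  set F := T (hf.toLp f) with hF
  set G := T (hg.toLp g) with hG
  have i1 := fun {a b : Sph d → ℝ} (ha : MemLp a 2 (sphMeasure d))
      (hb : MemLp b 2 (sphMeasure d)) =>
    integrable_continuous_mul_mul (continuous_zonal d k)
      (ha.integrable one_le_two) (hb.integrable one_le_two)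
  have e := fun {a b : Sph d → ℝ} (ha : MemLp a 2 (sphMeasure d))
      (hb : MemLp b 2 (sphMeasure d)) =>
    (integral_zonal_mul_mul hd hT ha hb).trans (by rw [← inner_proj_proj hT])
  have key : zonalForm d k (fun x => (f x : ℂ) + g x * Complex.I) =
      ((S * ‖F‖ ^ 2 - S * ‖G‖ ^ 2 : ℝ) : ℂ) +
        ((S * inner ℝ F G + S * inner ℝ G F : ℝ) : ℂ) * Complex.I := by
    rw [← real_inner_self_eq_norm_sq, ← real_inner_self_eq_norm_sq]
    rw [← e hf hf, ← e hg hg, ← e hf hg, ← e hg hf, ← integral_sub (i1 hf hf) (i1 hg hg),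
      ← integral_add (i1 hf hg) (i1 hg hf), ← integral_complex_ofReal, ← integral_complex_ofReal,
      ← integral_mul_const, ← integral_add, zonalForm]
    · refine integral_congr_ae (.of_forall fun p => ?_)
      push_cast
      linear_combination (zonal d k p : ℂ) * g p.1 * g p.2 * Complex.I_sq
    · exact ((i1 hf hf).sub (i1 hg hg)).ofReal
    · exact ((i1 hf hg).add (i1 hg hf)).ofReal.mul_const _
  rw [key, real_inner_comm F G]
  refine (sq_le_sq₀ (norm_nonneg _) (by positivity)).1 ?_
  rw [← Complex.normSq_eq_norm_sq, Complex.normSq_add_mul_I]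
  have hcs := abs_le.1 (abs_real_inner_le_norm F G)
  have : (inner ℝ F G) ^ 2 ≤ (‖F‖ * ‖G‖) ^ 2 := by nlinarith
  nlinarith [mul_le_mul_of_nonneg_left this (sq_nonneg S)]

lemma norm_ofReal_cpow_le {m M : ℝ} (hm : 0 ≤ m) (hM : m ≤ M) (hM1 : 1 ≤ M) {v : ℂ} {b : ℝ}
    (hv : 0 < v.re) (hb : v.re ≤ b) : ‖(m : ℂ) ^ v‖ ≤ M ^ b := by
  rw [Complex.norm_cpow_eq_rpow_re_of_nonneg hm hv.ne']
  exact (Real.rpow_le_rpow hm hM hv.le).trans (Real.rpow_le_rpow_of_exponent_le hM1 hb)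

lemma hasDerivAt_ofReal_const_cpow (m : ℝ) {v : ℂ} (hv : 0 < v.re) :
    HasDerivAt (fun v : ℂ => (m : ℂ) ^ v) ((m : ℂ) ^ v * Complex.log m) v := by
  have := (hasDerivAt_id v).const_cpow (c := (m : ℂ)) 
    (Or.inr (show v ≠ 0 from fun h => by simp [h] at hv))
  simpa using this

/-- An integral of complex powers of a bounded nonnegative function is holomorphic. -/
lemma differentiableAt_integral_mul_cpow {X : Type*} [MeasurableSpace X] {ν : Measure X}
    [IsFiniteMeasure ν] {K : X → ℂ} {m : X → ℝ} {B M : ℝ} (hK : AEStronglyMeasurable K ν)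
    (hB : ∀ p, ‖K p‖ ≤ B) (hm : Measurable m) (hm0 : ∀ p, 0 ≤ m p) (hmM : ∀ p, m p ≤ M)
    (hM1 : 1 ≤ M) {v₀ : ℂ} (hv₀ : 0 < v₀.re) :
    DifferentiableAt ℂ (fun v => ∫ p, K p * (m p : ℂ) ^ v ∂ν) v₀ := by
  set a := v₀.re with ha
  have hmeas : ∀ v : ℂ, AEStronglyMeasurable (fun p => K p * (m p : ℂ) ^ v) ν := fun v =>
    hK.mul ((Complex.measurable_ofReal.comp hm).pow_const v).aestronglyMeasurable
  have hre : ∀ {v w : ℂ} {r : ℝ}, dist v w ≤ r → |v.re - w.re| ≤ r := fun {v w r} h => by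
    rw [dist_eq_norm] at h
    exact (Complex.abs_re_le_norm (v - w)).trans h
  refine (hasDerivAt_integral_of_dominated_loc_of_deriv_le (s := ball v₀ (a / 2))
    (F' := fun v p => K p * ((m p : ℂ) ^ v * Complex.log (m p)))
    (bound := fun _ => B * (M ^ (2 * a) / (a / 4)))
    (ball_mem_nhds _ (by positivity)) (.of_forall hmeas) ?_ ?_ ?_ (integrable_const _)
    ?_).2.differentiableAt
  · refine Integrable.of_bound (hmeas v₀) (B * M ^ a) (.of_forall fun p => ?_)
    rw [norm_mul]
    exact mul_le_mul (hB p) (norm_ofReal_cpow_le (hm0 p) (hmM p) hM1 hv₀ le_rfl) (norm_nonneg _)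
      ((norm_nonneg _).trans (hB p))
  · have := Complex.measurable_ofReal.comp hm
    exact hK.mul ((this.pow_const v₀).mul
      (Complex.measurable_log.comp this)).aestronglyMeasurable
  · refine .of_forall fun p v hv => ?_
    have h1 := abs_le.1 (hre (le_of_lt (mem_ball.1 hv)))
    rw [norm_mul]
    refine mul_le_mul (hB p) ?_ (norm_nonneg _) ((norm_nonneg _).trans (hB p))
    have hdc : DiffContOnCl ℂ (fun v : ℂ => (m p : ℂ) ^ v) (ball v (a / 4)) := by
      refine DifferentiableOn.diffContOnCl fun w hw => ?_
      have h2 := abs_le.1 (hre (mem_closedBall.1 (closure_ball_subset_closedBall hw)))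
      exact (hasDerivAt_ofReal_const_cpow _
        (by linarith)).differentiableAt.differentiableWithinAt
    have := Complex.norm_deriv_le_of_forall_mem_sphere_norm_le (C := M ^ (2 * a)) (by positivity)
      hdc fun w hw => ?_
    · rwa [(hasDerivAt_ofReal_const_cpow _ (by linarith)).deriv] at this
    · have h2 := abs_le.1 (hre (le_of_eq (mem_sphere.1 hw)))
      exact norm_ofReal_cpow_le (hm0 p) (hmM p) hM1 (by linarith) (by linarith)
  · refine .of_forall fun p v hv => ?_
    have h1 := abs_le.1 (hre (le_of_lt (mem_ball.1 hv)))
    exact (hasDerivAt_ofReal_const_cpow _ (by linarith)).const_mul _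

/-- The function `h |h|^v`. -/
def powFn {d : ℕ} (h : Sph d → ℝ) (v : ℂ) (x : Sph d) : ℂ := (h x : ℂ) * ((|h x| : ℝ) : ℂ) ^ v

lemma continuous_powFn {d : ℕ} {h : Sph d → ℝ} (hh : Continuous h) {v : ℂ} (hv : 0 < v.re) :
    Continuous (powFn h v) :=
  (Complex.continuous_ofReal.comp hh).mul
    ((Complex.continuous_ofReal_cpow_const hv).comp hh.abs)

lemma norm_powFn {d : ℕ} (h : Sph d → ℝ) {v : ℂ} (hv : 0 < v.re) (x : Sph d) :
    ‖powFn h v x‖ = |h x| ^ (v.re + 1) := by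
  rw [powFn, norm_mul, Complex.norm_cpow_eq_rpow_re_of_nonneg (abs_nonneg _) hv.ne',
    Complex.norm_real, Real.norm_eq_abs, Real.rpow_add_one' (abs_nonneg _) (by linarith), mul_comm]

lemma powFn_ofReal {d : ℕ} (h : Sph d → ℝ) (v : ℝ) (x : Sph d) :
    powFn h v x = ((h x * |h x| ^ v : ℝ) : ℂ) := by
  rw [powFn, ← Complex.ofReal_cpow (abs_nonneg _)]
  push_cast
  rfl

lemma memLp_of_continuous {d : ℕ} {E : Type*} [NormedAddCommGroup E] {u : Sph d → E}
    (hu : Continuous u) (p : ℝ≥0∞) : MemLp u p (sphMeasure d) := by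
  obtain ⟨C, hC⟩ := (isCompact_range hu).isBounded.exists_norm_le
  exact MemLp.of_bound hu.aestronglyMeasurable C (.of_forall fun x => hC _ ⟨x, rfl⟩)

lemma zonalForm_powFn {d : ℕ} (k : ℕ) (h : Sph d → ℝ) (v : ℂ) :
    zonalForm d k (powFn h v) = ∫ p, ((zonal d k p : ℂ) * (h p.1 * h p.2)) *
      ((|h p.1| * |h p.2| : ℝ) : ℂ) ^ v ∂((sphMeasure d).prod (sphMeasure d)) := by
  refine integral_congr_ae (.of_forall fun p => ?_)
  simp only [powFn]
  rw [Complex.ofReal_mul, Complex.mul_cpow_ofReal_nonneg (abs_nonneg _) (abs_nonneg _)]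
  ring

lemma differentiableAt_zonalForm_powFn {d : ℕ} (k : ℕ) {h : Sph d → ℝ} (hh : Continuous h)
    {v₀ : ℂ} (hv₀ : 0 < v₀.re) :
    DifferentiableAt ℂ (fun v => zonalForm d k (powFn h v)) v₀ := by
  obtain ⟨M, hM⟩ := (isCompact_range hh).isBounded.exists_norm_le
  have hK : Continuous fun p : Sph d × Sph d => (zonal d k p : ℂ) * (h p.1 * h p.2) := by
    have := continuous_zonal d k
    fun_prop
  obtain ⟨B, hB⟩ := (isCompact_range hK).isBounded.exists_norm_le
  simp only [zonalForm_powFn]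
  refine differentiableAt_integral_mul_cpow (B := B) (M := max 1 (M * M)) hK.aestronglyMeasurable
    (fun p => hB _ ⟨p, rfl⟩) (Continuous.measurable (by fun_prop)) (fun p => by positivity)
    (fun p => le_max_of_le_right ?_) (le_max_left _ _) hv₀
  exact mul_le_mul (hM _ ⟨p.1, rfl⟩) (hM _ ⟨p.2, rfl⟩) (abs_nonneg _)
    ((norm_nonneg _).trans (hM _ ⟨p.1, rfl⟩))

lemma exists_norm_zonalForm_powFn_le {d : ℕ} (k : ℕ) {h : Sph d → ℝ} (hh : Continuous h) (b : ℝ) :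
    ∃ C : ℝ, ∀ v : ℂ, 0 < v.re → v.re ≤ b → ‖zonalForm d k (powFn h v)‖ ≤ C := by
  obtain ⟨M, hM⟩ := (isCompact_range hh).isBounded.exists_norm_le
  have hK : Continuous fun p : Sph d × Sph d => (zonal d k p : ℂ) * (h p.1 * h p.2) := by
    have := continuous_zonal d k
    fun_prop
  obtain ⟨B, hB⟩ := (isCompact_range hK).isBounded.exists_norm_le
  refine ⟨B * max 1 (M * M) ^ b * ((sphMeasure d).prod (sphMeasure d)).real Set.univ,
    fun v hv hb => ?_⟩
  rw [zonalForm_powFn]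
  refine norm_integral_le_of_norm_le_const (.of_forall fun p => ?_)
  rw [norm_mul]
  refine mul_le_mul (hB _ ⟨p, rfl⟩) (norm_ofReal_cpow_le (by positivity)
    (le_max_of_le_right ?_) (le_max_left _ _) hv hb) (norm_nonneg _)
    ((norm_nonneg _).trans (hB _ ⟨p, rfl⟩))
  exact mul_le_mul (hM _ ⟨p.1, rfl⟩) (hM _ ⟨p.2, rfl⟩) (abs_nonneg _)
    ((norm_nonneg _).trans (hM _ ⟨p.1, rfl⟩))

/-- The bilinear form of the kernel family. -/
def kernelForm (d n : ℕ) (z : ℂ) (u : Sph d → ℂ) : ℂ :=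
  ∑ k ∈ Finset.range (n + 1), sqCoef z (n - k) * zonalForm d k u

lemma kernelForm_eq_integral {d : ℕ} (n : ℕ) (z : ℂ) {u : Sph d → ℂ}
    (hu : Integrable u (sphMeasure d)) :
    kernelForm d n z u = ∫ p, kernelFam (((d : ℝ) - 2) / 2) n z
      (inner ℝ (p.1 : EuclideanSpace ℝ (Fin d)) (p.2 : EuclideanSpace ℝ (Fin d))) *
        (u p.1 * u p.2) ∂((sphMeasure d).prod (sphMeasure d)) := by
  have hi : ∀ k, Integrable (fun p : Sph d × Sph d => (zonal d k p : ℂ) * (u p.1 * u p.2))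
      ((sphMeasure d).prod (sphMeasure d)) := fun k =>
    integrable_continuous_mul_mul (Complex.continuous_ofReal.comp (continuous_zonal d k)) hu hu
  simp only [kernelForm, zonalForm, ← integral_const_mul]
  rw [← integral_finsetSum _ fun k _ => (hi k).const_mul _]
  refine integral_congr_ae (.of_forall fun p => ?_)
  simp only [kernelFam, Finset.sum_mul]
  refine Finset.sum_congr rfl fun k _ => ?_
  rw [zonal]
  ring

lemma norm_kernelForm_le_sq {d : ℕ} (hd : 3 ≤ d)
    {proj : ℕ → Lp ℝ 2 (sphMeasure d) → Lp ℝ 2 (sphMeasure d)}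
    (hproj : ∀ k, IsOrthProjOnto d k (proj k)) (n : ℕ) {z : ℂ} (hz : z.re = -1)
    {u : Sph d → ℂ} (hu : Continuous u) :
    ‖kernelForm d n z u‖ ≤ Real.exp (z.im ^ 2) * ((sphMeasure d).real Set.univ *
      ∫ x, ‖u x‖ ^ 2 ∂(sphMeasure d)) := by
  have hf := memLp_of_continuous (Complex.continuous_re.comp hu) 2
  have hg := memLp_of_continuous (Complex.continuous_im.comp hu) 2
  have hsum : ‖hf.toLp _‖ ^ 2 + ‖hg.toLp _‖ ^ 2 = ∫ x, ‖u x‖ ^ 2 ∂(sphMeasure d) := by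
    rw [← real_inner_self_eq_norm_sq, ← real_inner_self_eq_norm_sq, inner_toLp, inner_toLp]
    refine (integral_add (hf.integrable_mul hf) (hg.integrable_mul hg)).symm.trans
      (integral_congr_ae (.of_forall fun x => ?_))
    simp only [Pi.mul_apply, Function.comp, Complex.sq_norm, Complex.normSq_apply]
  have hS0 : 0 ≤ (sphMeasure d).real Set.univ := measureReal_nonneg
  have hu' : u = fun x => (((Complex.re ∘ u) x : ℝ) : ℂ) + ((Complex.im ∘ u) x : ℝ) * Complex.I :=
    funext fun x => (Complex.re_add_im (u x)).symm
  calc ‖kernelForm d n z u‖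
      ≤ ∑ k ∈ Finset.range (n + 1), Real.exp (z.im ^ 2) * ((sphMeasure d).real Set.univ *
        (‖proj k (hf.toLp _)‖ ^ 2 + ‖proj k (hg.toLp _)‖ ^ 2)) := by
        refine norm_sum_le_of_le _ fun k _ => ?_
        rw [norm_mul]
        refine mul_le_mul (norm_sqCoef_le_of_re_eq_neg_one hz _) ?_ (norm_nonneg _)
          (Real.exp_pos _).le
        have := norm_zonalForm_le hd (hproj k) hf hg
        rwa [← hu'] at this
    _ = Real.exp (z.im ^ 2) * ((sphMeasure d).real Set.univ *
        (∑ k ∈ Finset.range (n + 1), ‖proj k (hf.toLp _)‖ ^ 2 +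
          ∑ k ∈ Finset.range (n + 1), ‖proj k (hg.toLp _)‖ ^ 2)) := by
        rw [← Finset.sum_add_distrib, Finset.mul_sum, Finset.mul_sum]
    _ ≤ _ := by
        rw [← hsum]
        gcongr <;> exact sum_norm_proj_sq_le hd hproj _ _

lemma exists_norm_kernelForm_le {d : ℕ} (hd : 3 ≤ d) : ∃ C : ℝ, 0 < C ∧ ∀ n : ℕ, 1 ≤ n →
    ∀ z : ℂ, z.re = ((d : ℝ) - 2) / 2 → ∀ u : Sph d → ℂ, Continuous u →
      ‖kernelForm d n z u‖ ≤ C * (n : ℝ) ^ (((d : ℝ) - 2) / 2) *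
        Real.exp (Real.pi / 2 * |z.im|) * (∫ x, ‖u x‖ ∂(sphMeasure d)) ^ 2 := by
  have hd' : (3 : ℝ) ≤ d := by exact_mod_cast hd
  obtain ⟨C, hC, h⟩ := exists_norm_kernelFam_le (l := ((d : ℝ) - 2) / 2) (by linarith)
  refine ⟨C, hC, fun n hn z hz u hu => ?_⟩
  have hui := (memLp_of_continuous hu 1).integrable le_rfl
  rw [kernelForm_eq_integral n z hui, sq, ← integral_prod_mul, ← integral_const_mul]
  refine norm_integral_le_of_norm_le ((hui.norm.mul_prod hui.norm).const_mul _)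
    (.of_forall fun p => ?_)
  rw [norm_mul, norm_mul]
  refine mul_le_mul_of_nonneg_right (h n hn z hz _ ?_) (by positivity)
  refine (abs_real_inner_le_norm _ _).trans ?_
  simp

lemma zonalForm_powFn_ofReal {d k : ℕ} (hd : 3 ≤ d)
    {T : Lp ℝ 2 (sphMeasure d) → Lp ℝ 2 (sphMeasure d)} (hT : IsOrthProjOnto d k T)
    {h : Sph d → ℝ} {v : ℝ} (hf : MemLp (fun x => h x * |h x| ^ v) 2 (sphMeasure d)) :
    zonalForm d k (powFn h v) =
      (((sphMeasure d).real Set.univ * ‖T (hf.toLp _)‖ ^ 2 : ℝ) : ℂ) := by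
  rw [← real_inner_self_eq_norm_sq, inner_proj_proj hT, ← integral_zonal_mul_mul hd hT hf hf,
    ← integral_complex_ofReal, zonalForm]
  refine integral_congr_ae (.of_forall fun p => ?_)
  simp only [powFn_ofReal]
  push_cast
  rfl

lemma kernelForm_zero (d n : ℕ) (u : Sph d → ℂ) : kernelForm d n 0 u = zonalForm d n u := by
  rw [kernelForm, Finset.sum_eq_single n]
  · simp [sqCoef]
  · intro k hk hkn
    have := Finset.mem_range.1 hk
    rw [sqCoef_zero_left, if_neg (by omega), zero_mul]
  · intro h
    simp at h

lemma sphMeasure_real_univ_pos {d : ℕ} (hd : 3 ≤ d) : 0 < (sphMeasure d).real Set.univ := by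
  have : NeZero d := ⟨by omega⟩
  have : Nonempty (Fin d) := ⟨0⟩
  have : NeZero (sphMeasure d) := ⟨Measure.toSphere_ne_zero _⟩
  exact measureReal_univ_pos

lemma norm_gaussFactor (A : ℝ) (τ : ℂ) :
    ‖Complex.exp (A * τ ^ 2)‖ = Real.exp (A * (τ.re ^ 2 - τ.im ^ 2)) := by
  rw [Complex.norm_exp, Complex.re_ofReal_mul, sq, Complex.mul_re]
  ring_nf

/-- The analytic family used for Stein interpolation. -/
def steinFam (d n : ℕ) (l : ℝ) (h : Sph d → ℝ) (τ : ℂ) : ℂ :=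
  Complex.exp (((l + 1) ^ 2 : ℝ) * τ ^ 2) *
    kernelForm d n ((l + 1 : ℝ) * τ - 1) (powFn h ((1 / l : ℝ) + (1 + 1 / l : ℝ) * τ))

lemma steinParam_re (l : ℝ) (τ : ℂ) :
    ((1 / l : ℝ) + (1 + 1 / l : ℝ) * τ : ℂ).re = 1 / l + (1 + 1 / l) * τ.re := by
  rw [Complex.add_re, Complex.re_ofReal_mul, Complex.ofReal_re]

lemma steinOrder_re (l : ℝ) (τ : ℂ) : ((l + 1 : ℝ) * τ - 1 : ℂ).re = (l + 1) * τ.re - 1 := by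
  rw [Complex.sub_re, Complex.re_ofReal_mul, Complex.one_re]

lemma steinOrder_im (l : ℝ) (τ : ℂ) : ((l + 1 : ℝ) * τ - 1 : ℂ).im = (l + 1) * τ.im := by
  rw [Complex.sub_im, Complex.im_ofReal_mul, Complex.one_im, sub_zero]

lemma steinParam_re_pos {l : ℝ} (hl : 0 < l) {τ : ℂ} (hτ : 0 ≤ τ.re) :
    0 < ((1 / l : ℝ) + (1 + 1 / l : ℝ) * τ : ℂ).re := by
  rw [steinParam_re]
  positivity

lemma diffContOnCl_steinFam {d : ℕ} (n : ℕ) {l : ℝ} (hl : 0 < l) {h : Sph d → ℝ}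
    (hh : Continuous h) :
    DiffContOnCl ℂ (steinFam d n l h) (Complex.HadamardThreeLines.verticalStrip 0 1) := by
  refine DifferentiableOn.diffContOnCl fun τ hτ => ?_
  have hτ0 : 0 ≤ τ.re := by
    have h1 : closure (Complex.HadamardThreeLines.verticalStrip 0 1) ⊆ {z : ℂ | 0 ≤ z.re} :=
      closure_minimal (fun z hz => hz.1.le) (isClosed_le continuous_const Complex.continuous_re)
    exact h1 hτ
  refine DifferentiableAt.differentiableWithinAt ?_
  unfold steinFam kernelForm
  refine DifferentiableAt.mul (by fun_prop) (DifferentiableAt.fun_sum fun k _ => ?_)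
  refine DifferentiableAt.mul ?_ ?_
  · exact (differentiable_sqCoef (n - k)).differentiableAt.comp τ
      (f := fun τ : ℂ => ((l + 1 : ℝ) * τ - 1 : ℂ)) (by fun_prop)
  · exact DifferentiableAt.comp τ (g := fun v => zonalForm d k (powFn h v))
      (f := fun τ : ℂ => ((1 / l : ℝ) + (1 + 1 / l : ℝ) * τ : ℂ))
      (differentiableAt_zonalForm_powFn k hh (steinParam_re_pos hl hτ0)) (by fun_prop)

lemma bddAbove_steinFam {d : ℕ} (n : ℕ) {l : ℝ} (hl : 0 < l) {h : Sph d → ℝ}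
    (hh : Continuous h) :
    BddAbove ((norm ∘ steinFam d n l h) ''
      Complex.HadamardThreeLines.verticalClosedStrip 0 1) := by
  choose C hC using fun k => exists_norm_zonalForm_powFn_le k hh (1 / l + (1 + 1 / l))
  refine ⟨Real.exp ((l + 1) ^ 2) * ∑ k ∈ Finset.range (n + 1), (1 + l) ^ (n - k) * C k, ?_⟩
  rintro _ ⟨τ, ⟨h0, h1⟩, rfl⟩
  have hp := steinParam_re_pos hl h0
  have hp1 : ((1 / l : ℝ) + (1 + 1 / l : ℝ) * τ : ℂ).re ≤ 1 / l + (1 + 1 / l) := by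
    rw [steinParam_re]
    have : (1 + 1 / l) * τ.re ≤ (1 + 1 / l) * 1 := by gcongr
    linarith
  have hb : ‖kernelForm d n ((l + 1 : ℝ) * τ - 1)
      (powFn h ((1 / l : ℝ) + (1 + 1 / l : ℝ) * τ))‖ ≤ Real.exp (((l + 1) * τ.im) ^ 2) *
        ∑ k ∈ Finset.range (n + 1), (1 + l) ^ (n - k) * C k := by
    rw [Finset.mul_sum]
    refine norm_sum_le_of_le _ fun k _ => ?_
    rw [norm_mul]
    have h2 := norm_sqCoef_le_of_mem_strip hl.le (z := (l + 1 : ℝ) * τ - 1)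
      (by rw [steinOrder_re]; nlinarith) (by rw [steinOrder_re]; nlinarith) (n - k)
    rw [steinOrder_im] at h2
    calc _ ≤ ((1 + l) ^ (n - k) * Real.exp (((l + 1) * τ.im) ^ 2)) * C k := by
          gcongr
          exact hC k _ hp hp1
      _ = _ := by ring
  have hs : 0 ≤ ∑ k ∈ Finset.range (n + 1), (1 + l) ^ (n - k) * C k :=
    Finset.sum_nonneg fun k _ => mul_nonneg (by positivity)
      ((norm_nonneg _).trans (hC k _ hp hp1))
  rw [Function.comp, steinFam, norm_mul, norm_gaussFactor]
  calc _ ≤ Real.exp ((l + 1) ^ 2 * (τ.re ^ 2 - τ.im ^ 2)) * (Real.exp (((l + 1) * τ.im) ^ 2) *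
        ∑ k ∈ Finset.range (n + 1), (1 + l) ^ (n - k) * C k) := by gcongr
    _ = Real.exp ((l + 1) ^ 2 * τ.re ^ 2) *
        ∑ k ∈ Finset.range (n + 1), (1 + l) ^ (n - k) * C k := by
      rw [← mul_assoc, ← Real.exp_add]
      ring_nf
    _ ≤ _ := by
      gcongr
      have : τ.re ^ 2 ≤ 1 := pow_le_one₀ h0 h1
      nlinarith [sq_nonneg (l + 1)]

lemma norm_steinFam_le_left {d : ℕ} (hd : 3 ≤ d)
    {proj : ℕ → Lp ℝ 2 (sphMeasure d) → Lp ℝ 2 (sphMeasure d)}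
    (hproj : ∀ k, IsOrthProjOnto d k (proj k)) (n : ℕ) {l : ℝ} (hl : 0 < l) {h : Sph d → ℝ}
    (hh : Continuous h) {τ : ℂ} (hτ : τ.re = 0) :
    ‖steinFam d n l h τ‖ ≤ (sphMeasure d).real Set.univ *
      ∫ x, |h x| ^ (2 + 2 / l) ∂(sphMeasure d) := by
  have hp := steinParam_re_pos hl hτ.ge
  have h1 := norm_kernelForm_le_sq hd hproj n (z := (l + 1 : ℝ) * τ - 1)
    (by rw [steinOrder_re, hτ]; ring) (continuous_powFn hh hp)
  have h2 : ∀ x, ‖powFn h ((1 / l : ℝ) + (1 + 1 / l : ℝ) * τ) x‖ ^ 2 = |h x| ^ (2 + 2 / l) := by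
    intro x
    rw [norm_powFn h hp, steinParam_re, hτ, ← Real.rpow_mul_natCast (abs_nonneg _)]
    congr 1
    push_cast
    ring
  simp only [h2] at h1
  rw [steinFam, norm_mul, norm_gaussFactor, hτ]
  rw [steinOrder_im] at h1
  refine (mul_le_mul_of_nonneg_left h1 (Real.exp_pos _).le).trans_eq ?_
  rw [← mul_assoc, ← Real.exp_add]
  have : (l + 1) ^ 2 * (0 ^ 2 - τ.im ^ 2) + ((l + 1) * τ.im) ^ 2 = 0 := by ring
  rw [this, Real.exp_zero, one_mul]

lemma exists_norm_steinFam_le_right {d : ℕ} (hd : 3 ≤ d) {l : ℝ} (hl : l = ((d : ℝ) - 2) / 2) :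
    ∃ C : ℝ, 0 < C ∧ ∀ n : ℕ, 1 ≤ n → ∀ h : Sph d → ℝ, Continuous h → ∀ τ : ℂ, τ.re = 1 →
      ‖steinFam d n l h τ‖ ≤ C * (n : ℝ) ^ l *
        (∫ x, |h x| ^ (2 + 2 / l) ∂(sphMeasure d)) ^ 2 := by
  have hd' : (3 : ℝ) ≤ d := by exact_mod_cast hd
  have hl0 : 0 < l := by linarith
  obtain ⟨C, hC, H⟩ := exists_norm_kernelForm_le hd
  refine ⟨Real.exp ((l + 1) ^ 2 + 1) * C, by positivity, fun n hn h hh τ hτ => ?_⟩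
  have hp := steinParam_re_pos hl0 (τ := τ) (by rw [hτ]; exact zero_le_one)
  have h1 := H n hn ((l + 1 : ℝ) * τ - 1) (by rw [steinOrder_re, hτ, ← hl]; ring) _
    (continuous_powFn hh hp)
  have h2 : ∀ x, ‖powFn h ((1 / l : ℝ) + (1 + 1 / l : ℝ) * τ) x‖ = |h x| ^ (2 + 2 / l) := by
    intro x
    rw [norm_powFn h hp, steinParam_re, hτ]
    congr 1
    ring
  simp only [h2] at h1
  rw [steinOrder_im, ← hl, abs_mul, abs_of_pos (by linarith : 0 < l + 1)] at h1
  rw [steinFam, norm_mul, norm_gaussFactor, hτ]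
  set N := ∫ x, |h x| ^ (2 + 2 / l) ∂(sphMeasure d)
  calc _ ≤ Real.exp ((l + 1) ^ 2 * (1 ^ 2 - τ.im ^ 2)) * (C * (n : ℝ) ^ l *
        Real.exp (Real.pi / 2 * ((l + 1) * |τ.im|)) * N ^ 2) := by gcongr
    _ = Real.exp ((l + 1) ^ 2 * (1 ^ 2 - τ.im ^ 2) + Real.pi / 2 * ((l + 1) * |τ.im|)) *
        (C * (n : ℝ) ^ l * N ^ 2) := by rw [Real.exp_add]; ring
    _ ≤ Real.exp ((l + 1) ^ 2 + 1) * (C * (n : ℝ) ^ l * N ^ 2) := by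
      refine mul_le_mul_of_nonneg_right (Real.exp_le_exp.2 ?_) (by positivity)
      rw [← sq_abs τ.im]
      set s := (l + 1) * |τ.im| with hs
      have : (l + 1) ^ 2 * (1 ^ 2 - |τ.im| ^ 2) = (l + 1) ^ 2 - s ^ 2 := by rw [hs]; ring
      rw [this]
      have hs0 : 0 ≤ s := by positivity
      have hpi : Real.pi / 2 * s ≤ 2 * s := by
        gcongr
        linarith [Real.pi_le_four]
      nlinarith [sq_nonneg (s - 1)]
    _ = _ := by ring

/-- The dual endpoint estimate. -/
lemma exists_norm_proj_sq_le {d : ℕ} (hd : 3 ≤ d) {l : ℝ} (hl : l = ((d : ℝ) - 2) / 2)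
    {proj : ℕ → Lp ℝ 2 (sphMeasure d) → Lp ℝ 2 (sphMeasure d)}
    (hproj : ∀ k, IsOrthProjOnto d k (proj k)) :
    ∃ C : ℝ, 0 < C ∧ ∀ n : ℕ, 1 ≤ n → ∀ h : Sph d → ℝ, Continuous h →
      ∀ hf : MemLp (fun x => h x * |h x| ^ (2 / l)) 2 (sphMeasure d),
      ‖proj n (hf.toLp _)‖ ^ 2 ≤ C * (n : ℝ) ^ (l / (l + 1)) *
        (∫ x, |h x| ^ (2 + 2 / l) ∂(sphMeasure d)) ^ (1 + 1 / (l + 1)) := by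
  have hd' : (3 : ℝ) ≤ d := by exact_mod_cast hd
  have hl0 : 0 < l := by linarith
  obtain ⟨C, hC, H⟩ := exists_norm_steinFam_le_right hd hl
  have hS := sphMeasure_real_univ_pos hd
  set S := (sphMeasure d).real Set.univ with hS_def
  set t : ℝ := 1 / (l + 1) with ht
  have ht0 : 0 ≤ t := by positivity
  have ht1 : t ≤ 1 := by rw [ht, div_le_one (by linarith)]; linarith
  refine ⟨S⁻¹ * (S ^ (1 - t) * C ^ t), by positivity, fun n hn h hh hf => ?_⟩
  set N := ∫ x, |h x| ^ (2 + 2 / l) ∂(sphMeasure d) with hN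
  have hN0 : 0 ≤ N := integral_nonneg fun x => by positivity
  have key := Complex.HadamardThreeLines.norm_le_interp_of_mem_verticalClosedStrip₀₁'
    (steinFam d n l h) (z := (t : ℂ)) ⟨by simpa using ht0, by simpa using ht1⟩
    (diffContOnCl_steinFam n hl0 hh)
    (bddAbove_steinFam n hl0 hh) (fun τ hτ => norm_steinFam_le_left hd hproj n hl0 hh hτ)
    (fun τ hτ => H n hn h hh τ hτ)
  rw [Complex.ofReal_re, ← hS_def, ← hN] at key
  have hz : ((l + 1 : ℝ) * (t : ℂ) - 1 : ℂ) = 0 := by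
    rw [← Complex.ofReal_mul, ht, mul_one_div_cancel (by linarith)]
    simp
  have hv : ((1 / l : ℝ) + (1 + 1 / l : ℝ) * (t : ℂ) : ℂ) = ((2 / l : ℝ) : ℂ) := by
    rw [← Complex.ofReal_mul, ← Complex.ofReal_add, ht]
    congr 1
    field_simp
    ring
  have hval : S * ‖proj n (hf.toLp _)‖ ^ 2 ≤ ‖steinFam d n l h t‖ := by
    rw [steinFam, hz, hv, kernelForm_zero, zonalForm_powFn_ofReal hd (hproj n) hf, norm_mul,
      norm_gaussFactor, Complex.norm_real, Real.norm_of_nonneg (by positivity)]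
    refine le_mul_of_one_le_left (by positivity) (Real.one_le_exp ?_)
    simp
    positivity
  have hr : (S * N) ^ (1 - t) * (C * (n : ℝ) ^ l * N ^ 2) ^ t =
      S * (S⁻¹ * (S ^ (1 - t) * C ^ t) * (n : ℝ) ^ (l / (l + 1)) * N ^ (1 + t)) := by
    rw [Real.mul_rpow hS.le hN0, Real.mul_rpow (by positivity) (by positivity),
      Real.mul_rpow hC.le (by positivity), ← Real.rpow_mul (by positivity),
      ← Real.rpow_natCast N 2, ← Real.rpow_mul hN0, ht, mul_one_div, ← ht]
    have : N ^ (1 + t) = N ^ (1 - t) * N ^ (((2 : ℕ) : ℝ) * t) := by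
      rw [← Real.rpow_add_of_nonneg hN0 (by linarith) (by positivity)]
      congr 1
      push_cast
      ring
    rw [this]
    field_simp
  rw [hr] at key
  exact le_of_mul_le_mul_left (hval.trans key) hS

lemma integral_rpow_mul_rpow_le {X : Type*} [MeasurableSpace X] {μ : Measure X} {f g : X → ℝ}
    (hf : Integrable f μ) (hg : Integrable g μ) (hf0 : ∀ x, 0 ≤ f x) (hg0 : ∀ x, 0 ≤ g x)
    {a b : ℝ} (ha : 0 ≤ a) (hb : 0 ≤ b) (hab : a + b = 1) :
    ∫ x, f x ^ a * g x ^ b ∂μ ≤ (∫ x, f x ∂μ) ^ a * (∫ x, g x ∂μ) ^ b := by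
  have hF : 0 ≤ ∫ x, f x ∂μ := integral_nonneg hf0
  have hG : 0 ≤ ∫ x, g x ∂μ := integral_nonneg hg0
  rw [integral_eq_lintegral_of_nonneg_ae
    (.of_forall fun x => mul_nonneg (Real.rpow_nonneg (hf0 x) _) (Real.rpow_nonneg (hg0 x) _))
    ((hf.1.aemeasurable.pow_const a).mul (hg.1.aemeasurable.pow_const b)).aestronglyMeasurable]
  refine ENNReal.toReal_le_of_le_ofReal (by positivity) ?_
  rw [ENNReal.ofReal_mul (by positivity), ← ENNReal.ofReal_rpow_of_nonneg hF ha,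
    ← ENNReal.ofReal_rpow_of_nonneg hG hb, ofReal_integral_eq_lintegral_ofReal hf (.of_forall hf0),
    ofReal_integral_eq_lintegral_ofReal hg (.of_forall hg0)]
  refine le_trans (le_of_eq (lintegral_congr fun x => ?_)) (ENNReal.lintegral_mul_norm_pow_le
    hf.1.aemeasurable.ennreal_ofReal hg.1.aemeasurable.ennreal_ofReal ha hb hab)
  rw [ENNReal.ofReal_mul (Real.rpow_nonneg (hf0 x) _), ENNReal.ofReal_rpow_of_nonneg (hf0 x) ha,
    ENNReal.ofReal_rpow_of_nonneg (hg0 x) hb]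

lemma norm_toLp_sq {d : ℕ} {h : Sph d → ℝ} (hh : MemLp h 2 (sphMeasure d)) :
    ‖hh.toLp h‖ ^ 2 = ∫ x, |h x| ^ (2 : ℝ) ∂(sphMeasure d) := by
  rw [← real_inner_self_eq_norm_sq, inner_toLp]
  refine integral_congr_ae (.of_forall fun x => ?_)
  simp [← sq]

/-- The `L² → L^{2 + 2/λ}` bound for spherical harmonics. -/
lemma exists_integral_rpow_le {d : ℕ} (hd : 3 ≤ d) {l : ℝ} (hl : l = ((d : ℝ) - 2) / 2)
    {proj : ℕ → Lp ℝ 2 (sphMeasure d) → Lp ℝ 2 (sphMeasure d)}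
    (hproj : ∀ k, IsOrthProjOnto d k (proj k)) :
    ∃ C : ℝ, 0 < C ∧ ∀ n : ℕ, 1 ≤ n → ∀ h : Sph d → ℝ, Continuous h →
      ∀ hh : MemLp h 2 (sphMeasure d), hh.toLp h ∈ Hspace d n →
      ∫ x, |h x| ^ (2 + 2 / l) ∂(sphMeasure d) ≤
        (C * (n : ℝ) ^ (l / (l + 1)) * ‖hh.toLp h‖ ^ 2) ^ ((l + 1) / l) := by
  have hd' : (3 : ℝ) ≤ d := by exact_mod_cast hd
  have hl0 : 0 < l := by linarith
  obtain ⟨C, hC, H⟩ := exists_norm_proj_sq_le hd hl hproj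
  refine ⟨C, hC, fun n hn h hhc hh hmem => ?_⟩
  have hf : MemLp (fun x => h x * |h x| ^ (2 / l)) 2 (sphMeasure d) :=
    memLp_of_continuous (hhc.mul (hhc.abs.rpow_const fun _ => Or.inr (by positivity))) 2
  have h1 := H n hn h hhc hf
  set N := ∫ x, |h x| ^ (2 + 2 / l) ∂(sphMeasure d) with hN
  have hN0 : 0 ≤ N := integral_nonneg fun x => by positivity
  have h2 : N = inner ℝ (proj n (hf.toLp _)) (hh.toLp h) := by
    rw [inner_proj_left (hproj n) _ hmem, inner_toLp, hN]
    refine integral_congr_ae (.of_forall fun x => ?_)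
    dsimp only
    rw [Real.rpow_add_of_nonneg (abs_nonneg _) zero_le_two (by positivity), Real.rpow_two, sq_abs]
    ring
  rcases hN0.eq_or_lt with h0 | hpos
  · rw [← h0]; positivity
  have h3 : N ^ 2 ≤ (‖proj n (hf.toLp _)‖ * ‖hh.toLp h‖) ^ 2 := by
    gcongr
    exact h2.le.trans (real_inner_le_norm _ _)
  have h4 : N ^ (1 + 1 / (l + 1)) * N ^ (l / (l + 1)) = N ^ 2 := by
    rw [← Real.rpow_add hpos, ← Real.rpow_two]
    congr 1
    field_simp
    ring
  have h5 : N ^ (l / (l + 1)) ≤ C * (n : ℝ) ^ (l / (l + 1)) * ‖hh.toLp h‖ ^ 2 := by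
    have hp : 0 < N ^ (1 + 1 / (l + 1)) := by positivity
    refine le_of_mul_le_mul_left ?_ hp
    rw [h4]
    refine h3.trans ?_
    rw [mul_pow]
    calc _ ≤ (C * (n : ℝ) ^ (l / (l + 1)) * N ^ (1 + 1 / (l + 1))) * ‖hh.toLp h‖ ^ 2 := by gcongr
      _ = _ := by ring
  calc N = (N ^ (l / (l + 1))) ^ ((l + 1) / l) := by
        rw [← Real.rpow_mul hN0, div_mul_div_cancel₀ (by linarith), div_self hl0.ne',
          Real.rpow_one]
    _ ≤ _ := by gcongr

lemma exists_integral_rpow_rpow_inv_le {d : ℕ} (hd : 3 ≤ d) {l : ℝ} (hl : l = ((d : ℝ) - 2) / 2)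
    {proj : ℕ → Lp ℝ 2 (sphMeasure d) → Lp ℝ 2 (sphMeasure d)}
    (hproj : ∀ k, IsOrthProjOnto d k (proj k)) {r : ℝ} (hr1 : 2 ≤ r) (hr2 : r ≤ 2 + 2 / l) :
    ∃ C : ℝ, 0 < C ∧ ∀ n : ℕ, 1 ≤ n → ∀ h : Sph d → ℝ, Continuous h →
      ∀ hh : MemLp h 2 (sphMeasure d), hh.toLp h ∈ Hspace d n →
      (∫ x, |h x| ^ r ∂(sphMeasure d)) ^ r⁻¹ ≤
        C * (n : ℝ) ^ (l * (1 / 2 - 1 / r)) * ‖hh.toLp h‖ := by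
  have hd' : (3 : ℝ) ≤ d := by exact_mod_cast hd
  have hl0 : 0 < l := by linarith
  have hr0 : 0 < r := by linarith
  obtain ⟨C, hC, H⟩ := exists_integral_rpow_le hd hl hproj
  set b : ℝ := (r - 2) * l / 2 with hb_def
  have hb : 0 ≤ b := by
    have : 0 ≤ r - 2 := by linarith
    positivity
  have hb1 : b ≤ 1 := by
    have : (r - 2) * l ≤ 2 / l * l := by gcongr; linarith
    rw [div_mul_cancel₀ _ hl0.ne'] at this
    rw [hb_def]
    linarith
  refine ⟨C ^ ((l + 1) / l * b * r⁻¹), by positivity, fun n hn h hhc hh hmem => ?_⟩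
  have hn0 : (0 : ℝ) < n := by exact_mod_cast hn
  have hi : ∀ s : ℝ, 0 ≤ s → Integrable (fun x => |h x| ^ s) (sphMeasure d) := fun s hs =>
    (memLp_of_continuous (hhc.abs.rpow_const fun _ => Or.inr hs) 1).integrable le_rfl
  have hN0 : 0 ≤ ∫ x, |h x| ^ (2 + 2 / l) ∂(sphMeasure d) := integral_nonneg fun x => by positivity
  have h1 := integral_rpow_mul_rpow_le (hi 2 zero_le_two) (hi (2 + 2 / l) (by positivity))
    (fun x => by positivity) (fun x => by positivity) (sub_nonneg.2 hb1) hb (by ring)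
  have h2 : ∀ x, (|h x| ^ (2 : ℝ)) ^ (1 - b) * (|h x| ^ (2 + 2 / l)) ^ b = |h x| ^ r := by
    intro x
    have : 0 ≤ 1 - b := by linarith
    rw [← Real.rpow_mul (abs_nonneg _), ← Real.rpow_mul (abs_nonneg _),
      ← Real.rpow_add_of_nonneg (abs_nonneg _) (by positivity) (by positivity)]
    congr 1
    rw [hb_def]
    field_simp
    ring
  simp only [h2] at h1
  rw [← norm_toLp_sq hh] at h1
  set M := ‖hh.toLp h‖ with hM
  have hM0 : 0 ≤ M := norm_nonneg _
  have hI0 : 0 ≤ ∫ x, |h x| ^ r ∂(sphMeasure d) := integral_nonneg fun x => by positivity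
  have h3 : ∫ x, |h x| ^ r ∂(sphMeasure d) ≤ (M ^ 2) ^ (1 - b) *
      ((C * (n : ℝ) ^ (l / (l + 1)) * M ^ 2) ^ ((l + 1) / l)) ^ b := by
    refine h1.trans ?_
    gcongr
    exact H n hn h hhc hh hmem
  refine (Real.rpow_le_rpow hI0 h3 (by positivity)).trans_eq ?_
  have hb1' : 0 ≤ 1 - b := by linarith
  rw [← Real.rpow_natCast M 2, ← Real.rpow_mul (by positivity) _ b,
    Real.mul_rpow (by positivity) (by positivity),
    ← Real.rpow_mul (by positivity) ((l + 1) / l * b),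
    Real.mul_rpow (x := C * (n : ℝ) ^ (l / (l + 1))) (by positivity) (by positivity),
    Real.mul_rpow hC.le (by positivity)]
  simp only [← Real.rpow_mul hM0, ← Real.rpow_mul hn0.le]
  have e1 : l / (l + 1) * ((l + 1) / l * b * r⁻¹) = l * (1 / 2 - 1 / r) := by
    rw [hb_def]
    field_simp
  have e2 : M ^ (((2 : ℕ) : ℝ) * (1 - b) * r⁻¹) *
      M ^ (((2 : ℕ) : ℝ) * ((l + 1) / l * b * r⁻¹)) = M := by
    rw [← Real.rpow_add_of_nonneg hM0 (by positivity) (by positivity)]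
    conv_rhs => rw [← Real.rpow_one M]
    congr 1
    rw [hb_def]
    push_cast
    field_simp
    ring
  rw [e1]
  linear_combination C ^ ((l + 1) / l * b * r⁻¹) * (n : ℝ) ^ (l * (1 / 2 - 1 / r)) * e2

lemma two_add_two_div_eq_ofReal {d : ℕ} (hd : 3 ≤ d) :
    (2 : ℝ≥0∞) + 2 / (((d : ℝ≥0∞) - 2) / 2) = ENNReal.ofReal (2 + 2 / (((d : ℝ) - 2) / 2)) := by
  have hd' : (3 : ℝ) ≤ d := by exact_mod_cast hd
  have h1 : 0 < ((d : ℝ) - 2) / 2 := by linarith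
  rw [ENNReal.ofReal_add zero_le_two (by positivity), ENNReal.ofReal_div_of_pos h1,
    ENNReal.ofReal_div_of_pos zero_lt_two, ENNReal.ofReal_sub _ zero_le_two]
  simp

/-- Lemma 2.1(iv) (Sogge): if `2 ≤ q ≤ 2 + 2/λ` with `λ = (d-2)/2`, then
`‖proj_n f‖_q ≤ C n^{λ(1/2 - 1/q)} ‖f‖_2` for all `f ∈ L²(S^{d-1}, σ)`. -/
theorem proj_bound_iv
    (d : ℕ) (hd : 3 ≤ d) (q : ℝ≥0∞)
    (hq1 : 2 ≤ q) (hq2 : q ≤ 2 + 2 / (((d : ℝ≥0∞) - 2) / 2))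
    (proj : ℕ → Lp ℝ 2 (sphMeasure d) → Lp ℝ 2 (sphMeasure d))
    (hproj : ∀ k, IsOrthProjOnto d k (proj k)) :
    ∃ C : ℝ, 0 < C ∧ ∀ n : ℕ, 1 ≤ n → ∀ f : Lp ℝ 2 (sphMeasure d),
      eLpNorm (⇑(proj n f)) q (sphMeasure d) ≤
        ENNReal.ofReal
            (C * (n : ℝ) ^ ((((d : ℝ) - 2) / 2) * (1 / 2 - 1 / q.toReal))) *
          eLpNorm (⇑f) 2 (sphMeasure d) := by
  have hd' : (3 : ℝ) ≤ d := by exact_mod_cast hd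
  have hl0 : 0 < ((d : ℝ) - 2) / 2 := by linarith
  rw [two_add_two_div_eq_ofReal hd] at hq2
  have hq_top : q ≠ ⊤ := (hq2.trans_lt ENNReal.ofReal_lt_top).ne
  have hq_zero : q ≠ 0 := fun h => by simp [h] at hq1
  have hr1 : 2 ≤ q.toReal := by
    simpa using ENNReal.toReal_mono hq_top hq1
  have hr2 : q.toReal ≤ 2 + 2 / (((d : ℝ) - 2) / 2) :=
    ENNReal.toReal_le_of_le_ofReal (by positivity) hq2
  obtain ⟨C, hC, H⟩ := exists_integral_rpow_rpow_inv_le hd rfl hproj hr1 hr2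
  refine ⟨C, hC, fun n hn f => ?_⟩
  obtain ⟨P, -, -, hP⟩ := exists_polyEval_of_mem_Hspace (hproj n f).1
  have hc := continuous_polyEval_sph P
  have h1 := H n hn _ hc (memLp_polyEval P 2) (hP ▸ (hproj n f).1)
  rw [← hP] at h1
  have h2 : eLpNorm (⇑(proj n f)) q (sphMeasure d) = ENNReal.ofReal
      ((∫ x : Sph d, |polyEval (x : EuclideanSpace ℝ (Fin d)) P| ^ q.toReal ∂(sphMeasure d)) ^
        (q.toReal)⁻¹) := by
    rw [hP, eLpNorm_congr_ae (MemLp.coeFn_toLp (memLp_polyEval P 2)),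
      MemLp.eLpNorm_eq_integral_rpow_norm hq_zero hq_top (memLp_polyEval P q)]
    rfl
  rw [h2, ← Lp.enorm_def, ← ofReal_norm, ← ENNReal.ofReal_mul (by positivity)]
  refine ENNReal.ofReal_le_ofReal (h1.trans ?_)
  gcongr
  exact norm_proj_le (hproj n) f
end
end

section
/- Let d ≥ 3, λ = (d−2)/2, and fix 0 < p < ∞. For each n ∈ ℕ define f_n : S^{d-1} → ℂ by f_n(x) = (x_1 + i·x_2)^n. Then f_n is the restriction to S^{d-1} of a (complex-valued) polynomial homogeneous of degree n whose Laplacian vanishes identically, and there exist constants c, C > 0 such that for all integers n ≥ 1, c · n^{−λ/p} ≤ ‖f_n‖_p ≤ C · n^{−λ/p}. -/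
open MeasureTheory Metric
open scoped ENNReal

noncomputable section

/-- The function `f_n(x) = (x₁ + i x₂)^n` on the unit sphere `S^{d-1}` (for `d ≥ 3`). -/
def fHighest (d : ℕ) (hd : 3 ≤ d) (n : ℕ) (x : Sph d) : ℂ :=
  (((x : EuclideanSpace ℝ (Fin d)) ⟨0, by omega⟩ : ℂ) +
      Complex.I * ((x : EuclideanSpace ℝ (Fin d)) ⟨1, by omega⟩ : ℂ)) ^ n

theorem Real.Gamma_add_le_rpow_mul_Gamma {s L : ℝ} (hs : 0 < s) (hL : 0 < L) :
    Real.Gamma (s + L) ≤ (s + L) ^ L * Real.Gamma s := by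
  have hy : 0 < s + L := by positivity
  have hG := Real.Gamma_pos_of_pos hs
  have hGy := Real.Gamma_pos_of_pos hy
  have h := Real.Gamma_mul_add_mul_le_rpow_Gamma_mul_rpow_Gamma (s := s) (t := s + L + 1)
    (a := 1 / (L + 1)) (b := L / (L + 1)) hs (by positivity) (by positivity) (by positivity)
    (by field_simp; ring)
  have e : 1 / (L + 1) * s + L / (L + 1) * (s + L + 1) = s + L := by field_simp; ring
  rw [e, Real.Gamma_add_one hy.ne'] at h
  have h2 := Real.rpow_le_rpow hGy.le h (by positivity : 0 ≤ L + 1)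
  rw [Real.mul_rpow (by positivity) (by positivity), ← Real.rpow_mul hG.le,
    ← Real.rpow_mul (by positivity), div_mul_cancel₀ _ (by positivity),
    div_mul_cancel₀ _ (by positivity), Real.rpow_one, Real.mul_rpow hy.le hGy.le,
    Real.rpow_add hGy, Real.rpow_one] at h2
  have hp : 0 < Real.Gamma (s + L) ^ L := by positivity
  refine le_of_mul_le_mul_left ?_ hp
  linarith

theorem Real.rpow_mul_Gamma_add_one_le {x L : ℝ} (hx : 0 < x) (hL : 0 < L) :
    x ^ L * Real.Gamma (x + 1) ≤ Real.Gamma (x + 1 + L) := by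
  have hG := Real.Gamma_pos_of_pos hx
  have hGy := Real.Gamma_pos_of_pos (by positivity : 0 < x + 1 + L)
  have h := Real.Gamma_mul_add_mul_le_rpow_Gamma_mul_rpow_Gamma (s := x) (t := x + 1 + L)
    (a := L / (L + 1)) (b := 1 / (L + 1)) hx (by positivity) (by positivity) (by positivity)
    (by field_simp)
  have e : L / (L + 1) * x + 1 / (L + 1) * (x + 1 + L) = x + 1 := by field_simp; ring
  rw [e, Real.Gamma_add_one hx.ne'] at h
  have h2 := Real.rpow_le_rpow (by positivity) h (by positivity : 0 ≤ L + 1)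
  rw [Real.mul_rpow (x := Real.Gamma x ^ _) (by positivity) (by positivity),
    ← Real.rpow_mul hG.le,
    ← Real.rpow_mul (by positivity), div_mul_cancel₀ _ (by positivity),
    div_mul_cancel₀ _ (by positivity), Real.rpow_one,
    Real.rpow_add (by positivity), Real.rpow_one, Real.mul_rpow hx.le hG.le] at h2
  rw [Real.Gamma_add_one hx.ne']
  have hp : 0 < Real.Gamma x ^ L := by positivity
  refine le_of_mul_le_mul_left ?_ hp
  linarith

open Measure in
/-- Integration in polar coordinates of a homogeneous function against a Gaussian. -/
theorem integral_mul_exp_neg_norm_sq_of_homogeneous {E : Type*} [NormedAddCommGroup E]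
    [NormedSpace ℝ E] [Nontrivial E] [MeasurableSpace E] [FiniteDimensional ℝ E] [BorelSpace E]
    (μ : Measure E) [μ.IsAddHaarMeasure] {s : ℝ} (hs : 0 ≤ s) (h : E → ℝ)
    (hh : ∀ t : ℝ, 0 < t → ∀ x, h (t • x) = t ^ s * h x) :
    ∫ x, h x * Real.exp (-‖x‖ ^ 2) ∂μ =
      (∫ ω : sphere (0 : E) 1, h ω ∂μ.toSphere) *
        (1 / 2 * Real.Gamma ((s + Module.finrank ℝ E) / 2)) := by
  have hdim : 0 < Module.finrank ℝ E := Module.finrank_pos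
  calc
    ∫ x, h x * Real.exp (-‖x‖ ^ 2) ∂μ
      = ∫ x : ({(0)}ᶜ : Set E), h x * Real.exp (-‖x.1‖ ^ 2) ∂(μ.comap (↑)) := by
      rw [integral_subtype_comap (measurableSet_singleton _).compl
        fun x ↦ h x * Real.exp (-‖x‖ ^ 2), restrict_compl_singleton]
    _ = ∫ x : sphere (0 : E) 1 × Set.Ioi (0 : ℝ),
          h x.1 * ((x.2 : ℝ) ^ s * Real.exp (-(x.2 : ℝ) ^ 2))
          ∂μ.toSphere.prod (.volumeIoiPow (Module.finrank ℝ E - 1)) := by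
      rw [← μ.measurePreserving_homeomorphUnitSphereProd.integral_comp
        (Homeomorph.measurableEmbedding _)]
      refine integral_congr_ae (Filter.Eventually.of_forall fun x ↦ ?_)
      have hx : 0 < ‖x.1‖ := norm_pos_iff.2 x.2
      have := hh ‖x.1‖ hx (‖x.1‖⁻¹ • x.1)
      rw [smul_smul, mul_inv_cancel₀ hx.ne', one_smul] at this
      simp only [homeomorphUnitSphereProd_apply_snd_coe, homeomorphUnitSphereProd_apply_fst_coe]
      rw [this]
      ring
    _ = (∫ ω : sphere (0 : E) 1, h ω ∂μ.toSphere) *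
        ∫ r : Set.Ioi (0 : ℝ), (r : ℝ) ^ s * Real.exp (-(r : ℝ) ^ 2)
          ∂(.volumeIoiPow (Module.finrank ℝ E - 1)) :=
      integral_prod_mul (fun ω : sphere (0 : E) 1 ↦ h ω)
        (fun r : Set.Ioi (0 : ℝ) ↦ (r : ℝ) ^ s * Real.exp (-(r : ℝ) ^ 2))
    _ = _ := by
      congr 1
      have key := integral_rpow_mul_exp_neg_rpow (p := 2) (q := s + Module.finrank ℝ E - 1)
        two_pos (by have : (0 : ℝ) < Module.finrank ℝ E := by exact_mod_cast hdim
                    linarith)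
      rw [sub_add_cancel] at key
      rw [← key]
      simp only [Measure.volumeIoiPow, ENNReal.ofReal]
      rw [integral_withDensity_eq_integral_smul,
        integral_subtype_comap measurableSet_Ioi fun a ↦
          Real.toNNReal (a ^ (Module.finrank ℝ E - 1)) • (a ^ s * Real.exp (-a ^ 2)),
        setIntegral_congr_fun measurableSet_Ioi fun x hx ↦ ?_]
      · have hx : 0 < x := hx
        rw [NNReal.smul_def, Real.coe_toNNReal _ (by positivity), smul_eq_mul, ← mul_assoc,
          ← Real.rpow_natCast, ← Real.rpow_add hx, Nat.cast_sub (by omega)]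
        congr 2
        · push_cast; ring
        · norm_cast
      · exact (measurable_subtype_coe.pow_const _).real_toNNReal

theorem integral_finAdd_mul {m k : ℕ} (F : (Fin m → ℝ) → ℝ) (G : (Fin k → ℝ) → ℝ) :
    ∫ x : Fin (m + k) → ℝ, F (fun i ↦ x (Fin.castAdd k i)) * G (fun j ↦ x (Fin.natAdd m j)) =
      (∫ y, F y) * ∫ z, G z := by
  have h1 := (volume_measurePreserving_piCongrLeft (fun _ : Fin (m + k) ↦ ℝ)
    (finSumFinEquiv (m := m) (n := k))).symm
  have h2 := volume_measurePreserving_sumPiEquivProdPi (fun _ : Fin m ⊕ Fin k ↦ ℝ)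
  rw [← integral_prod_mul, ← Measure.volume_eq_prod,
    ← (h2.comp h1).integral_comp' (f :=
      (MeasurableEquiv.piCongrLeft (fun _ : Fin (m + k) ↦ ℝ) finSumFinEquiv).symm.trans
      (MeasurableEquiv.sumPiEquivProdPi (fun _ : Fin m ⊕ Fin k ↦ ℝ)))]
  rfl

theorem integral_norm_rpow_mul_exp_neg_norm_sq_euclidean (k : ℕ) {s : ℝ} (hs : 0 ≤ s) :
    ∫ x : EuclideanSpace ℝ (Fin (2 + k)),
      ‖(x (Fin.castAdd k 0) : ℂ) + Complex.I * (x (Fin.castAdd k 1) : ℂ)‖ ^ s *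
        Real.exp (-‖x‖ ^ 2) =
      Real.pi * Real.Gamma (s / 2 + 1) * √Real.pi ^ k := by
  have h1 : ∫ y : Fin 2 → ℝ, ‖(y 0 : ℂ) + Complex.I * (y 1 : ℂ)‖ ^ s *
      Real.exp (-(y 0 ^ 2 + y 1 ^ 2)) = Real.pi * Real.Gamma (s / 2 + 1) := by
    have h := Complex.integral_rpow_mul_exp_neg_rpow (p := 2) (q := s) one_le_two (by linarith)
    rw [← Complex.volume_preserving_equiv_pi.integral_comp
      Complex.measurableEquivPi.measurableEmbedding]
    rw [show Real.pi * Real.Gamma (s / 2 + 1) =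
      2 * Real.pi / 2 * Real.Gamma ((s + 2) / 2) by ring_nf, ← h]
    · refine integral_congr_ae (Filter.Eventually.of_forall fun z ↦ ?_)
      change ‖(z.re : ℂ) + Complex.I * (z.im : ℂ)‖ ^ s * Real.exp (-(z.re ^ 2 + z.im ^ 2)) =
        ‖z‖ ^ s * Real.exp (-‖z‖ ^ (2 : ℝ))
      rw [mul_comm Complex.I, Complex.re_add_im, Real.rpow_two, Complex.sq_norm,
        Complex.normSq_apply]
      ring_nf
  have h2 : ∫ z : Fin k → ℝ, ∏ i, Real.exp (-z i ^ 2) = √Real.pi ^ k := by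
    rw [integral_fintype_prod_volume_eq_pow (fun x : ℝ ↦ Real.exp (-x ^ 2)), Fintype.card_fin]
    have := integral_gaussian 1
    simp only [neg_mul, one_mul, div_one] at this
    rw [this]
  rw [← h1, ← h2, ← integral_finAdd_mul,
    ← (PiLp.volume_preserving_ofLp (Fin (2 + k))).integral_comp
      (MeasurableEquiv.toLp 2 _).symm.measurableEmbedding]
  refine integral_congr_ae (Filter.Eventually.of_forall fun x ↦ ?_)
  simp only [EuclideanSpace.norm_sq_eq, Real.norm_eq_abs, sq_abs]
  rw [mul_assoc, ← Real.exp_sum, ← Real.exp_add, Fin.sum_univ_add, Fin.sum_univ_two,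
    Finset.sum_neg_distrib]
  congr 2
  ring

theorem integral_sphere_norm_rpow (k : ℕ) {s : ℝ} (hs : 0 ≤ s) :
    ∫ x : Sph (2 + k), ‖((x : EuclideanSpace ℝ (Fin (2 + k))) (Fin.castAdd k 0) : ℂ) +
        Complex.I * ((x : EuclideanSpace ℝ (Fin (2 + k))) (Fin.castAdd k 1) : ℂ)‖ ^ s
        ∂sphMeasure (2 + k) =
      2 * Real.pi * √Real.pi ^ k *
        (Real.Gamma (s / 2 + 1) / Real.Gamma (s / 2 + 1 + (k : ℝ) / 2)) := by
  have : Nontrivial (EuclideanSpace ℝ (Fin (2 + k))) := by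
    have : Nonempty (Fin (2 + k)) := ⟨⟨0, by omega⟩⟩
    infer_instance
  have h := integral_mul_exp_neg_norm_sq_of_homogeneous
    (volume : Measure (EuclideanSpace ℝ (Fin (2 + k)))) hs
    (fun x ↦ ‖(x (Fin.castAdd k 0) : ℂ) + Complex.I * (x (Fin.castAdd k 1) : ℂ)‖ ^ s) (by
      intro t ht x
      rw [← Real.mul_rpow ht.le (norm_nonneg _)]
      congr 1
      have : t = ‖(t : ℂ)‖ := by rw [Complex.norm_real, Real.norm_of_nonneg ht.le]
      conv_rhs => rw [this, ← norm_mul]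
      simp only [PiLp.smul_apply, smul_eq_mul, Complex.ofReal_mul]
      congr 1
      ring)
  rw [integral_norm_rpow_mul_exp_neg_norm_sq_euclidean k hs, finrank_euclideanSpace_fin] at h
  have e : (s + ((2 + k : ℕ) : ℝ)) / 2 = s / 2 + 1 + (k : ℝ) / 2 := by push_cast; ring
  rw [e] at h
  have hG : 0 < Real.Gamma (s / 2 + 1 + (k : ℝ) / 2) := Real.Gamma_pos_of_pos (by positivity)
  rw [sphMeasure, ← mul_div_assoc, eq_div_iff hG.ne']
  linarith

open MvPolynomial in
theorem exists_harmonic_polynomial_fHighest (d : ℕ) (hd : 3 ≤ d) (n : ℕ) :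
    ∃ P : MvPolynomial (Fin d) ℂ, P.IsHomogeneous n ∧
      (∑ i : Fin d, MvPolynomial.pderiv i (MvPolynomial.pderiv i P)) = 0 ∧
      ∀ x : Sph d, fHighest d hd n x =
        MvPolynomial.eval (fun i => ((x : EuclideanSpace ℝ (Fin d)) i : ℂ)) P := by
  set Q : MvPolynomial (Fin d) ℂ := X ⟨0, by omega⟩ + C Complex.I * X ⟨1, by omega⟩ with hQ
  have hder : ∀ i, pderiv i Q = C ((Pi.single (⟨0, by omega⟩ : Fin d) 1 : Fin d → ℂ) i +
      Complex.I * (Pi.single (⟨1, by omega⟩ : Fin d) 1 : Fin d → ℂ) i) := by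
    intro i
    simp only [hQ, map_add, pderiv_C_mul, pderiv_X, Pi.single_apply, map_mul, eq_comm (a := i)]
    split_ifs <;> simp
  refine ⟨Q ^ n, ?_, ?_, ?_⟩
  · have h : Q.IsHomogeneous 1 :=
      (isHomogeneous_X _ _).add (by simpa using (isHomogeneous_C _ _).mul (isHomogeneous_X _ _))
    simpa using h.pow n
  · have h2 : ∀ i, pderiv i (pderiv i (Q ^ n)) =
        ((n * (n - 1 : ℕ) : ℕ) : MvPolynomial (Fin d) ℂ) * Q ^ (n - 1 - 1) *
          (pderiv i Q) ^ 2 := by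
      intro i
      have h0 : pderiv i (pderiv i Q) = 0 := by rw [hder, pderiv_C]
      simp only [Derivation.leibniz_pow, Derivation.leibniz, h0, nsmul_eq_mul, smul_eq_mul]
      rw [(pderiv i).map_natCast]
      push_cast
      ring
    simp only [h2, ← Finset.mul_sum]
    simp only [hder, ← map_pow, ← map_sum]
    have : ∀ i : Fin d, ((Pi.single (⟨0, by omega⟩ : Fin d) 1 : Fin d → ℂ) i +
      Complex.I * (Pi.single (⟨1, by omega⟩ : Fin d) 1 : Fin d → ℂ) i) ^ 2 =
      (Pi.single (⟨0, by omega⟩ : Fin d) 1 : Fin d → ℂ) i -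
      (Pi.single (⟨1, by omega⟩ : Fin d) 1 : Fin d → ℂ) i := by
      intro i
      simp only [Pi.single_apply, Fin.ext_iff]
      split_ifs
      · omega
      all_goals simp
    simp [this]
  · intro x
    simp [fHighest, hQ]

/-- Lemma 3.1 (Sogge): `f_n(x) = (x₁ + i x₂)^n` is a (complex-valued) spherical harmonic
of degree `n`, and `‖f_n‖_p ∼ n^{-λ/p}` for any fixed `0 < p < ∞`, where `λ = (d-2)/2`. -/
theorem fHighest_norm_asymp
    (d : ℕ) (hd : 3 ≤ d) (p : ℝ) (hp0 : 0 < p) :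
    (∀ n : ℕ, ∃ P : MvPolynomial (Fin d) ℂ, P.IsHomogeneous n ∧
      (∑ i : Fin d, MvPolynomial.pderiv i (MvPolynomial.pderiv i P)) = 0 ∧
      ∀ x : Sph d, fHighest d hd n x =
        MvPolynomial.eval (fun i => ((x : EuclideanSpace ℝ (Fin d)) i : ℂ)) P) ∧
    ∃ c C : ℝ, 0 < c ∧ 0 < C ∧ ∀ n : ℕ, 1 ≤ n →
      ENNReal.ofReal (c * (n : ℝ) ^ (-(((d : ℝ) - 2) / 2) / p)) ≤
          eLpNorm (fHighest d hd n) (ENNReal.ofReal p) (sphMeasure d) ∧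
        eLpNorm (fHighest d hd n) (ENNReal.ofReal p) (sphMeasure d) ≤
          ENNReal.ofReal (C * (n : ℝ) ^ (-(((d : ℝ) - 2) / 2) / p)) := by
  refine ⟨exists_harmonic_polynomial_fHighest d hd, ?_⟩
  obtain ⟨k, rfl⟩ := Nat.exists_eq_add_of_le (show 2 ≤ d by omega)
  have hk : (0 : ℝ) < k := by exact_mod_cast (show 0 < k by omega)
  set A : ℝ := 2 * Real.pi * √Real.pi ^ k with hA
  set L : ℝ := (k : ℝ) / 2 with hL
  have hLpos : 0 < L := by positivity
  have hApos : 0 < A := by have := Real.pi_pos; positivity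
  have hdL : (((2 + k : ℕ) : ℝ) - 2) / 2 = L := by push_cast; ring
  set M : ℝ := p / 2 + 1 + L with hM
  refine ⟨(A * M ^ (-L)) ^ p⁻¹, (A * (p / 2) ^ (-L)) ^ p⁻¹, by positivity, by positivity, ?_⟩
  intro n hn
  have hn1 : (1 : ℝ) ≤ n := by exact_mod_cast hn
  have hn0 : (0 : ℝ) < n := by linarith
  have hcont : Continuous (fHighest (2 + k) hd n) := by unfold fHighest; fun_prop
  have hbound : ∀ x : Sph (2 + k), ‖fHighest (2 + k) hd n x‖ ≤ 2 ^ n := by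
    intro x
    have hx : ∀ i, ‖(x : EuclideanSpace ℝ (Fin (2 + k))) i‖ ≤ 1 := fun i ↦
      (PiLp.norm_apply_le (x : EuclideanSpace ℝ (Fin (2 + k))) i).trans
        (norm_eq_of_mem_sphere x).le
    rw [fHighest, norm_pow]
    refine pow_le_pow_left₀ (norm_nonneg _) ((norm_add_le _ _).trans ?_) n
    rw [norm_mul, Complex.norm_I, one_mul, Complex.norm_real, Complex.norm_real]
    linarith [hx ⟨0, by omega⟩, hx ⟨1, by omega⟩]
  have : IsFiniteMeasure (sphMeasure (2 + k)) := by unfold sphMeasure; infer_instance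
  have hmem : MemLp (fHighest (2 + k) hd n) (ENNReal.ofReal p) (sphMeasure (2 + k)) :=
    MemLp.of_bound hcont.aestronglyMeasurable _ (Filter.Eventually.of_forall hbound)
  rw [hmem.eLpNorm_eq_integral_rpow_norm (by simpa using hp0) ENNReal.ofReal_ne_top,
    ENNReal.toReal_ofReal hp0.le]
  have hint : ∫ x, ‖fHighest (2 + k) hd n x‖ ^ p ∂sphMeasure (2 + k) =
      A * (Real.Gamma (n * p / 2 + 1) / Real.Gamma (n * p / 2 + 1 + L)) := by
    rw [← integral_sphere_norm_rpow k (s := n * p) (by positivity)]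
    refine integral_congr_ae (Filter.Eventually.of_forall fun x ↦ ?_)
    simp only [fHighest, norm_pow]
    rw [Real.rpow_mul (norm_nonneg _), Real.rpow_natCast]
    rfl
  have hG := Real.Gamma_pos_of_pos (by positivity : 0 < n * p / 2 + 1)
  have hG' := Real.Gamma_pos_of_pos (by positivity : 0 < n * p / 2 + 1 + L)
  have hlow := Real.rpow_mul_Gamma_add_one_le (by positivity : 0 < n * p / 2) hLpos
  have hup := Real.Gamma_add_le_rpow_mul_Gamma (by positivity : 0 < n * p / 2 + 1) hLpos
  have hscale : ∀ K : ℝ, 0 < K → (A * K ^ (-L)) ^ p⁻¹ * (n : ℝ) ^ (-L / p) =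
      (A * (n * K) ^ (-L)) ^ p⁻¹ := by
    intro K hK
    rw [div_eq_mul_inv (-L), Real.rpow_mul hn0.le, ← Real.mul_rpow (by positivity) (by positivity),
      Real.mul_rpow hn0.le hK.le]
    ring_nf
  rw [hint, hdL, hscale _ (by positivity), hscale _ (by positivity)]
  constructor
  · refine ENNReal.ofReal_le_ofReal (Real.rpow_le_rpow (by positivity) ?_ (by positivity))
    refine mul_le_mul_of_nonneg_left ?_ hApos.le
    rw [Real.rpow_neg (by positivity), le_div_iff₀ hG', inv_mul_le_iff₀ (by positivity)]
    refine hup.trans (mul_le_mul_of_nonneg_right (Real.rpow_le_rpow (by positivity) ?_ hLpos.le)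
      hG.le)
    rw [hM]
    nlinarith [mul_le_mul_of_nonneg_right hn1 hLpos.le]
  · refine ENNReal.ofReal_le_ofReal (Real.rpow_le_rpow (by positivity) ?_ (by positivity))
    refine mul_le_mul_of_nonneg_left ?_ hApos.le
    rw [Real.rpow_neg (by positivity), div_le_iff₀ hG', le_inv_mul_iff₀ (by positivity),
      ← mul_div_assoc]
    exact hlow
end
end
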